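/- arXiv:1605.01551 — 2 statements merged into one kernel-verified Lean document; each statement's English description precedes it below -/
import Mathlib

section
/- Assume (A3) and (A6), let (f₋, f₊) be the unique solution of Luckock's equation, and set Λ₋ := 1/(λ₋(I₋)λ₋(I₊)) − ∫_{Ī} (1/λ₊) d(1/λ₋) and Λ₊ := 1/(λ₊(I₋)λ₊(I₊)) + ∫_{Ī} (1/λ₋) d(1/λ₊). Then f₋(I₋) ≥ 0 if and only if Λ₋ ≥ 0, and f₊(I₊) ≥ 0 if and only if Λ₊ ≥ 0; both equivalences also hold with '≥' replaced by '≤' (hence also with strict inequalities and with equality). -/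
open MeasureTheory Set
open scoped ENNReal

noncomputable section

/-- The right limit of `f` at `x`, with the convention `f(b+) := f b` at the
right endpoint `b`. -/
def rLim (b : ℝ) (f : ℝ → ℝ) (x : ℝ) : ℝ :=
  if x < b then Function.rightLim f x else f b

/-- `ν` is the Lebesgue-Stieltjes signed measure `df` of `f` on the interval `[a,b]`,
with the conventions `f(a−) := f a` and `f(b+) := f b`. -/
def IsLS (a b : ℝ) (f : ℝ → ℝ) (ν : MeasureTheory.SignedMeasure ℝ) : Prop :=
  (∀ s : Set ℝ, MeasurableSet s → s ∩ Set.Icc a b = ∅ → ν s = 0) ∧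
  (∀ x y : ℝ, a ≤ x → x ≤ y → y ≤ b → ν (Set.Ioc x y) = rLim b f y - rLim b f x) ∧
  ν {a} = rLim b f a - f a

/-- The integral `∫_s g dν` of `g` over `s` against the signed measure `ν`. -/
def sInt (ν : MeasureTheory.SignedMeasure ℝ) (g : ℝ → ℝ) (s : Set ℝ) : ℝ :=
  (∫ x in s, g x ∂ν.toJordanDecomposition.posPart) -
    ∫ x in s, g x ∂ν.toJordanDecomposition.negPart

/-- Assumption (A3): `lm` (demand) is continuous and nonincreasing, `lp` (supply) is
continuous and nondecreasing on `[a,b]`; both are nonnegative. -/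
def A3 (a b : ℝ) (lm lp : ℝ → ℝ) : Prop :=
  ContinuousOn lm (Set.Icc a b) ∧ ContinuousOn lp (Set.Icc a b) ∧
  AntitoneOn lm (Set.Icc a b) ∧ MonotoneOn lp (Set.Icc a b) ∧
  (∀ x ∈ Set.Icc a b, 0 ≤ lm x) ∧ (∀ x ∈ Set.Icc a b, 0 ≤ lp x)

/-- Assumption (A6): the rates of market orders are positive. -/
def A6 (a b : ℝ) (lm lp : ℝ → ℝ) : Prop := 0 < lp a ∧ 0 < lm b

/-- `(fm, fp)` is a solution of Luckock's equation on `[a,b]` for demand/supply `lm, lp`: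
both are continuous of bounded variation, `fm dlp + lm dfp = 0` and `fp dlm + lp dfm = 0`
as signed measures on `[a,b]`, and `fm b = 1 = fp a`. -/
def LuckockSol (a b : ℝ) (lm lp fm fp : ℝ → ℝ) : Prop :=
  ContinuousOn fm (Set.Icc a b) ∧ ContinuousOn fp (Set.Icc a b) ∧
  BoundedVariationOn fm (Set.Icc a b) ∧ BoundedVariationOn fp (Set.Icc a b) ∧
  fm b = 1 ∧ fp a = 1 ∧
  ∀ νlm νlp νfm νfp : MeasureTheory.SignedMeasure ℝ,
    IsLS a b lm νlm → IsLS a b lp νlp → IsLS a b fm νfm → IsLS a b fp νfp →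
    ∀ s : Set ℝ, MeasurableSet s →
      sInt νlp fm s + sInt νfp lm s = 0 ∧ sInt νlm fp s + sInt νfm lp s = 0

section LebesgueStieltjes

variable {a b : ℝ} {f : ℝ → ℝ} {ν : SignedMeasure ℝ}

theorem rLim_eq_of_continuousOn (hf : ContinuousOn f (Icc a b)) {x : ℝ} (hx : x ∈ Icc a b) :
    rLim b f x = f x := by
  unfold rLim
  split_ifs with h
  · apply ContinuousWithinAt.rightLim_eq
    rw [← continuousWithinAt_Icc_iff_Ici h]
    exact (hf x hx).mono (Icc_subset_Icc_left hx.1)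
  · rw [le_antisymm hx.2 (not_lt.1 h)]

theorem IsLS.apply_Ioc (h : IsLS a b f ν) (hf : ContinuousOn f (Icc a b)) {x y : ℝ}
    (hx : a ≤ x) (hxy : x ≤ y) (hy : y ≤ b) : ν (Ioc x y) = f y - f x := by
  rw [h.2.1 x y hx hxy hy, rLim_eq_of_continuousOn hf ⟨hx, hxy.trans hy⟩,
    rLim_eq_of_continuousOn hf ⟨hx.trans hxy, hy⟩]

theorem IsLS.apply_left (h : IsLS a b f ν) (hab : a ≤ b) (hf : ContinuousOn f (Icc a b)) :
    ν {a} = 0 := by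
  rw [h.2.2, rLim_eq_of_continuousOn hf ⟨le_rfl, hab⟩, sub_self]

theorem exists_isLS (hab : a ≤ b) (hf : ContinuousOn f (Icc a b))
    (hbv : BoundedVariationOn f (Icc a b)) : ∃ ν : SignedMeasure ℝ, IsLS a b f ν := by
  set g : ℝ → ℝ := fun x => f (projIcc a b hab x) with hg
  have hgc : Continuous g := hf.domRestrict.comp continuous_projIcc
  have hgf : ∀ x ∈ Icc a b, g x = f x := fun x hx => by simp [hg, projIcc_of_mem hab hx]
  have hgbv : BoundedVariationOn g univ := by
    refine ne_top_of_le_ne_top hbv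
      (eVariationOn.comp_le_of_monotoneOn f (fun x => (projIcc a b hab x : ℝ)) ?_ ?_)
    · intro x _ y _ hxy
      exact monotone_projIcc hab hxy
    · exact fun x _ => (projIcc a b hab x).2
  have hr : ∀ x, Function.rightLim g x = g x := fun x =>
    hgc.continuousAt.continuousWithinAt.rightLim_eq
  have hl : ∀ x, Function.leftLim g x = g x := fun x =>
    hgc.continuousAt.continuousWithinAt.leftLim_eq
  refine ⟨hgbv.vectorMeasure.restrict (Icc a b), ?_, ?_, ?_⟩
  · intro s hs hsab
    rw [VectorMeasure.restrict_apply _ measurableSet_Icc hs, hsab, VectorMeasure.empty]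
  · intro x y hx hxy hy
    rw [VectorMeasure.restrict_apply _ measurableSet_Icc measurableSet_Ioc,
      inter_eq_left.2 (Ioc_subset_Icc_self.trans (Icc_subset_Icc hx hy)),
      hgbv.vectorMeasure_Ioc hxy, hr, hr, rLim_eq_of_continuousOn hf ⟨hx, hxy.trans hy⟩,
      rLim_eq_of_continuousOn hf ⟨hx.trans hxy, hy⟩, hgf _ ⟨hx, hxy.trans hy⟩,
      hgf _ ⟨hx.trans hxy, hy⟩]
  · rw [VectorMeasure.restrict_apply _ measurableSet_Icc (measurableSet_singleton a),
      inter_eq_left.2 (singleton_subset_iff.2 (left_mem_Icc.2 hab)), hgbv.vectorMeasure_singleton, hr, hl,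
      rLim_eq_of_continuousOn hf ⟨le_rfl, hab⟩, sub_self, sub_self]

theorem abs_signedMeasure_apply_le (ν : SignedMeasure ℝ) {s : Set ℝ} (hs : MeasurableSet s) :
    |ν s| ≤ ν.totalVariation.real s := by
  rw [ν.apply_eq_posPart_real_sub_negPart_real hs, SignedMeasure.totalVariation,
    measureReal_add_apply, abs_le]
  constructor <;>
    linarith [measureReal_nonneg (μ := ν.toJordanDecomposition.posPart) (s := s),
      measureReal_nonneg (μ := ν.toJordanDecomposition.negPart) (s := s)]

theorem abs_setIntegral_sub_le {μ : Measure ℝ} [IsFiniteMeasure μ] {g : ℝ → ℝ} {s : Set ℝ}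
    (hg : IntegrableOn g s μ) {c ε : ℝ} (h : ∀ x ∈ s, |g x - c| ≤ ε) :
    |(∫ x in s, g x ∂μ) - c * μ.real s| ≤ ε * μ.real s := by
  have h₁ : (∫ x in s, g x ∂μ) - c * μ.real s = ∫ x in s, (g x - c) ∂μ := by
    rw [integral_sub hg (integrable_const c)]
    simp [mul_comm]
  rw [h₁]
  exact norm_setIntegral_le_of_norm_le_const (f := fun x => g x - c) (measure_lt_top μ s) h

theorem abs_sInt_sub_le {g : ℝ → ℝ} (hg : ContinuousOn g (Icc a b)) {x y : ℝ} (hx : a ≤ x)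
    (hy : y ≤ b) {c ε : ℝ} (h : ∀ t ∈ Ioc x y, |g t - c| ≤ ε) :
    |sInt ν g (Ioc x y) - c * ν (Ioc x y)| ≤ ε * ν.totalVariation.real (Ioc x y) := by
  have hint (μ : Measure ℝ) [IsFiniteMeasure μ] : IntegrableOn g (Ioc x y) μ :=
    (hg.integrableOn_compact isCompact_Icc).mono_set
      (Ioc_subset_Icc_self.trans (Icc_subset_Icc hx hy))
  have h₁ := abs_setIntegral_sub_le (hint ν.toJordanDecomposition.posPart) h
  have h₂ := abs_setIntegral_sub_le (hint ν.toJordanDecomposition.negPart) h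
  rw [ν.apply_eq_posPart_real_sub_negPart_real measurableSet_Ioc, SignedMeasure.totalVariation,
    measureReal_add_apply, sInt]
  rw [abs_le] at *
  constructor <;> linarith

theorem sInt_Icc_sub {g : ℝ → ℝ} (hg : ContinuousOn g (Icc a b)) {x y : ℝ} (hx : a ≤ x)
    (hxy : x ≤ y) (hy : y ≤ b) :
    sInt ν g (Icc a y) - sInt ν g (Icc a x) = sInt ν g (Ioc x y) := by
  have key (μ : Measure ℝ) [IsFiniteMeasure μ] :
      ∫ t in Icc a y, g t ∂μ = (∫ t in Icc a x, g t ∂μ) + ∫ t in Ioc x y, g t ∂μ := by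
    have hint : IntegrableOn g (Icc a b) μ := hg.integrableOn_compact isCompact_Icc
    rw [← Icc_union_Ioc_eq_Icc hx hxy]
    refine setIntegral_union ?_ measurableSet_Ioc (hint.mono_set (Icc_subset_Icc_right
      (hxy.trans hy))) (hint.mono_set (Ioc_subset_Icc_self.trans (Icc_subset_Icc hx hy)))
    exact disjoint_left.2 fun t ht ht' => not_lt.2 ht.2 ht'.1
  simp only [sInt, key]
  ring

theorem sInt_Icc_self (g : ℝ → ℝ) (h : ν {a} = 0) : sInt ν g (Icc a a) = 0 := by
  rw [ν.apply_eq_posPart_real_sub_negPart_real (measurableSet_singleton a)] at h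
  simp only [sInt, Icc_self, integral_singleton, smul_eq_mul]
  rw [← sub_mul, h, zero_mul]

end LebesgueStieltjes

/-- The interval function `E x y` is uniformly `o(m (x, y])` as `y - x → 0` in `[a, b]`. -/
def NegligibleOn (a b : ℝ) (m : Measure ℝ) (E : ℝ → ℝ → ℝ) : Prop :=
  ∀ ε > 0, ∃ δ > 0, ∀ x y, a ≤ x → x ≤ y → y ≤ b → y - x < δ → |E x y| ≤ ε * m.real (Ioc x y)

namespace NegligibleOn

variable {a b : ℝ} {m : Measure ℝ} {E E' : ℝ → ℝ → ℝ}

theorem add (h : NegligibleOn a b m E) (h' : NegligibleOn a b m E') :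
    NegligibleOn a b m fun x y => E x y + E' x y := by
  intro ε hε
  obtain ⟨δ, hδ, H⟩ := h (ε / 2) (half_pos hε)
  obtain ⟨δ', hδ', H'⟩ := h' (ε / 2) (half_pos hε)
  refine ⟨min δ δ', lt_min hδ hδ', fun x y hx hxy hy hd => ?_⟩
  have h₁ := H x y hx hxy hy (hd.trans_le (min_le_left _ _))
  have h₂ := H' x y hx hxy hy (hd.trans_le (min_le_right _ _))
  exact (abs_add_le _ _).trans (by linarith)

theorem mul_left {c : ℝ → ℝ} (hc : ContinuousOn c (Icc a b)) (h : NegligibleOn a b m E) :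
    NegligibleOn a b m fun x y => c x * E x y := by
  intro ε hε
  obtain ⟨C, hC⟩ := isCompact_Icc.exists_bound_of_continuousOn hc
  have hC' : 0 < |C| + 1 := by positivity
  obtain ⟨δ, hδ, H⟩ := h (ε / (|C| + 1)) (div_pos hε hC')
  refine ⟨δ, hδ, fun x y hx hxy hy hd => ?_⟩
  have h₁ : |c x| ≤ |C| + 1 := by
    have := hC x ⟨hx, hxy.trans hy⟩
    rw [Real.norm_eq_abs] at this
    linarith [le_abs_self C]
  calc |c x * E x y| = |c x| * |E x y| := abs_mul _ _
    _ ≤ (|C| + 1) * (ε / (|C| + 1) * m.real (Ioc x y)) :=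
        mul_le_mul h₁ (H x y hx hxy hy hd) (abs_nonneg _) hC'.le
    _ = ε * m.real (Ioc x y) := by field_simp

theorem neg (h : NegligibleOn a b m E) : NegligibleOn a b m fun x y => -E x y := by
  simpa using h.mul_left (c := fun _ => -1) continuousOn_const

theorem congr (h : NegligibleOn a b m E)
    (hE : ∀ x y, a ≤ x → x ≤ y → y ≤ b → E' x y = E x y) : NegligibleOn a b m E' := by
  intro ε hε
  obtain ⟨δ, hδ, H⟩ := h ε hε
  exact ⟨δ, hδ, fun x y hx hxy hy hd => hE x y hx hxy hy ▸ H x y hx hxy hy hd⟩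

theorem mono [IsFiniteMeasure m] {m' : Measure ℝ} (h : NegligibleOn a b m' E) (hm : m' ≤ m) :
    NegligibleOn a b m E := by
  intro ε hε
  obtain ⟨δ, hδ, H⟩ := h ε hε
  refine ⟨δ, hδ, fun x y hx hxy hy hd => (H x y hx hxy hy hd).trans ?_⟩
  exact mul_le_mul_of_nonneg_left
    (ENNReal.toReal_mono (measure_ne_top m _) (hm _)) hε.le

end NegligibleOn

section

variable {a b : ℝ} {m : Measure ℝ}

theorem exists_abs_sub_le_of_continuousOn {g : ℝ → ℝ} (hg : ContinuousOn g (Icc a b)) {ε : ℝ}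
    (hε : 0 < ε) : ∃ δ > 0, ∀ x y, a ≤ x → x ≤ y → y ≤ b → y - x < δ → |g y - g x| ≤ ε := by
  obtain ⟨δ, hδ, H⟩ := Metric.uniformContinuousOn_iff.1
    (isCompact_Icc.uniformContinuousOn_of_continuous hg) ε hε
  refine ⟨δ, hδ, fun x y hx hxy hy hd => ?_⟩
  rw [← Real.dist_eq]
  refine (H y ⟨hx.trans hxy, hy⟩ x ⟨hx, hxy.trans hy⟩ ?_).le
  rwa [Real.dist_eq, abs_of_nonneg (sub_nonneg.2 hxy)]

theorem negligibleOn_mul_increments {f g : ℝ → ℝ} (hg : ContinuousOn g (Icc a b))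
    (hf : ∀ x y, a ≤ x → x ≤ y → y ≤ b → |f y - f x| ≤ m.real (Ioc x y)) :
    NegligibleOn a b m fun x y => (f y - f x) * (g y - g x) := by
  intro ε hε
  obtain ⟨δ, hδ, H⟩ := exists_abs_sub_le_of_continuousOn hg hε
  refine ⟨δ, hδ, fun x y hx hxy hy hd => ?_⟩
  rw [abs_mul, mul_comm]
  exact mul_le_mul (H x y hx hxy hy hd) (hf x y hx hxy hy) (abs_nonneg _) hε.le

theorem negligibleOn_sInt_sub {f g : ℝ → ℝ} {ν : SignedMeasure ℝ} (hν : IsLS a b f ν)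
    (hf : ContinuousOn f (Icc a b)) (hg : ContinuousOn g (Icc a b)) :
    NegligibleOn a b ν.totalVariation fun x y =>
      sInt ν g (Ioc x y) - g x * (f y - f x) := by
  intro ε hε
  obtain ⟨δ, hδ, H⟩ := exists_abs_sub_le_of_continuousOn hg hε
  refine ⟨δ, hδ, fun x y hx hxy hy hd => ?_⟩
  beta_reduce
  rw [← hν.apply_Ioc hf hx hxy hy]
  refine abs_sInt_sub_le hg hx hy fun t ht => H x t hx ht.1.le (ht.2.trans hy) ?_
  linarith [ht.2]

theorem NegligibleOn.le_of_sub_le [IsFiniteMeasure m] {E : ℝ → ℝ → ℝ}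
    (h : NegligibleOn a b m E) {F : ℝ → ℝ}
    (hF : ∀ x y, a ≤ x → x ≤ y → y ≤ b → F y - F x ≤ E x y) {x y : ℝ}
    (hx : a ≤ x) (hxy : x ≤ y) (hy : y ≤ b) : F y ≤ F x := by
  have key : ∀ ε > 0, F y - F x ≤ ε * m.real univ := by
    intro ε hε
    obtain ⟨δ, hδ, H⟩ := h ε hε
    obtain ⟨n, hn⟩ := exists_nat_gt ((y - x) / δ)
    have hn₀ : (0 : ℝ) < n := (div_nonneg (sub_nonneg.2 hxy) hδ.le).trans_lt hn
    set d : ℝ := (y - x) / n with hd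
    have hd₀ : 0 ≤ d := div_nonneg (sub_nonneg.2 hxy) hn₀.le
    have hdδ : d < δ := by
      rw [div_lt_iff₀ hδ] at hn
      rw [hd, div_lt_iff₀ hn₀]
      linarith
    have hnd : n * d = y - x := by rw [hd]; field_simp
    have step : ∀ i : ℕ, i ≤ n → F (x + i * d) - F x ≤ ε * m.real (Ioc x (x + i * d)) := by
      intro i
      induction i with
      | zero => intro _; simp
      | succ i ih =>
        intro hi
        have hid : (0 : ℝ) ≤ i * d := by positivity
        have hle : x + (i + 1 : ℕ) * d ≤ y := by
          have : ((i + 1 : ℕ) : ℝ) * d ≤ n * d :=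
            mul_le_mul_of_nonneg_right (by exact_mod_cast hi) hd₀
          linarith
        have hsucc : x + (i + 1 : ℕ) * d = x + i * d + d := by push_cast; ring
        have h₁ := ih (by omega)
        have h₂ := hF (x + i * d) (x + (i + 1 : ℕ) * d) (by linarith) (by linarith) (hle.trans hy)
        have h₃ := (le_abs_self _).trans (H (x + i * d) (x + (i + 1 : ℕ) * d) (by linarith)
          (by linarith) (hle.trans hy) (by linarith))
        have h₄ : m.real (Ioc x (x + (i + 1 : ℕ) * d)) = m.real (Ioc x (x + i * d)) +
            m.real (Ioc (x + i * d) (x + (i + 1 : ℕ) * d)) := by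
          rw [← measureReal_union (disjoint_left.2 fun t ht ht' => not_lt.2 ht.2 ht'.1)
            measurableSet_Ioc, Ioc_union_Ioc_eq_Ioc (by linarith) (by linarith)]
        rw [h₄, mul_add]
        linarith
    have h₁ := step n le_rfl
    rw [hnd, add_sub_cancel] at h₁
    exact h₁.trans (mul_le_mul_of_nonneg_left (measureReal_mono (subset_univ _)) hε.le)
  refine sub_nonpos.1 (le_of_forall_pos_le_add fun ε hε => ?_)
  have hM : 0 < m.real univ + 1 := by positivity
  have h₁ := key (ε / (m.real univ + 1)) (by positivity)
  have h₂ : ε / (m.real univ + 1) * m.real univ ≤ ε := by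
    rw [div_mul_eq_mul_div, div_le_iff₀ hM]
    nlinarith
  linarith

theorem NegligibleOn.eq_of_sub [IsFiniteMeasure m] {F : ℝ → ℝ}
    (h : NegligibleOn a b m fun x y => F y - F x) {x : ℝ} (hx : a ≤ x) (hy : x ≤ b) :
    F x = F a := by
  refine le_antisymm (h.le_of_sub_le (fun _ _ _ _ _ => le_rfl) le_rfl hx hy) ?_
  have := h.neg.le_of_sub_le (F := fun x => -F x) (fun _ _ _ _ _ => by linarith) le_rfl hx hy
  linarith

/-- If `f dk + l dg = 0` and `f k + g l = κ`, then `d(g / k) = κ / l d(1 / k)`. -/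
theorem div_sub_div_eq_mul_sInt [IsFiniteMeasure m] (hab : a ≤ b) {k l f g : ℝ → ℝ} {κ : ℝ}
    {ν : SignedMeasure ℝ} (hk : ContinuousOn k (Icc a b)) (hl : ContinuousOn l (Icc a b))
    (hf : ContinuousOn f (Icc a b)) (hk₀ : ∀ x ∈ Icc a b, 0 < k x)
    (hl₀ : ∀ x ∈ Icc a b, 0 < l x)
    (hkm : ∀ x y, a ≤ x → x ≤ y → y ≤ b → |k y - k x| ≤ m.real (Ioc x y))
    (hgm : ∀ x y, a ≤ x → x ≤ y → y ≤ b → |g y - g x| ≤ m.real (Ioc x y))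
    (hE : NegligibleOn a b m fun x y => f x * (k y - k x) + l x * (g y - g x))
    (hκ : ∀ x ∈ Icc a b, f x * k x + g x * l x = κ)
    (hν : IsLS a b (fun x => (k x)⁻¹) ν) (hνm : ν.totalVariation ≤ m) :
    g b * (k b)⁻¹ - g a * (k a)⁻¹ = κ * sInt ν (fun x => (l x)⁻¹) (Icc a b) := by
  have hq : ContinuousOn (fun x => (k x)⁻¹) (Icc a b) := hk.inv₀ fun x hx => (hk₀ x hx).ne'
  have hp : ContinuousOn (fun x => (l x)⁻¹) (Icc a b) := hl.inv₀ fun x hx => (hl₀ x hx).ne'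
  have hN : NegligibleOn a b m fun x y =>
      (g y * (k y)⁻¹ - κ * sInt ν (fun x => (l x)⁻¹) (Icc a y)) -
        (g x * (k x)⁻¹ - κ * sInt ν (fun x => (l x)⁻¹) (Icc a x)) := by
    refine ((((hE.mul_left (hq.mul hp)).add
      ((negligibleOn_mul_increments hq hkm).mul_left (hp.mul hf))).add
      (negligibleOn_mul_increments hq hgm)).add
      (((negligibleOn_sInt_sub hν hq hp).mono hνm).mul_left
        (continuousOn_const (c := -κ)))).congr fun x y hx hxy hy => ?_
    have hkx := (hk₀ x ⟨hx, hxy.trans hy⟩).ne'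
    have hky := (hk₀ y ⟨hx.trans hxy, hy⟩).ne'
    have hlx := (hl₀ x ⟨hx, hxy.trans hy⟩).ne'
    rw [← sInt_Icc_sub hp hx hxy hy, ← hκ x ⟨hx, hxy.trans hy⟩]
    simp only [Pi.mul_apply]
    field_simp
    ring
  have h := hN.eq_of_sub hab le_rfl
  rw [sInt_Icc_self _ (hν.apply_left hab hq)] at h
  linarith

theorem sInt_Icc_nonneg (hab : a ≤ b) {f g : ℝ → ℝ} {ν : SignedMeasure ℝ} (hν : IsLS a b f ν)
    (hf : ContinuousOn f (Icc a b)) (hmono : MonotoneOn f (Icc a b))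
    (hg : ContinuousOn g (Icc a b)) (hg₀ : ∀ x ∈ Icc a b, 0 ≤ g x) :
    0 ≤ sInt ν g (Icc a b) := by
  have h := (negligibleOn_sInt_sub hν hf hg).neg.le_of_sub_le
    (F := fun x => -sInt ν g (Icc a x)) (fun x y hx hxy hy => ?_) le_rfl hab le_rfl
  · rw [sInt_Icc_self _ (hν.apply_left hab hf)] at h
    linarith
  · have h₁ := mul_nonneg (hg₀ x ⟨hx, hxy.trans hy⟩)
      (sub_nonneg.2 (hmono ⟨hx, hxy.trans hy⟩ ⟨hx.trans hxy, hy⟩ hxy))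
    linarith [sInt_Icc_sub (ν := ν) hg hx hxy hy]

theorem sInt_Icc_nonpos (hab : a ≤ b) {f g : ℝ → ℝ} {ν : SignedMeasure ℝ} (hν : IsLS a b f ν)
    (hf : ContinuousOn f (Icc a b)) (hanti : AntitoneOn f (Icc a b))
    (hg : ContinuousOn g (Icc a b)) (hg₀ : ∀ x ∈ Icc a b, 0 ≤ g x) :
    sInt ν g (Icc a b) ≤ 0 := by
  have h := (negligibleOn_sInt_sub hν hf hg).le_of_sub_le
    (F := fun x => sInt ν g (Icc a x)) (fun x y hx hxy hy => ?_) le_rfl hab le_rfl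
  · rwa [sInt_Icc_self _ (hν.apply_left hab hf)] at h
  · have h₁ := mul_nonneg (hg₀ x ⟨hx, hxy.trans hy⟩)
      (sub_nonneg.2 (hanti ⟨hx, hxy.trans hy⟩ ⟨hx.trans hxy, hy⟩ hxy))
    linarith [sInt_Icc_sub (ν := ν) hg hx hxy hy]

theorem abs_sub_le_of_isLS [IsFiniteMeasure m] {f : ℝ → ℝ} {ν : SignedMeasure ℝ}
    (hν : IsLS a b f ν) (hf : ContinuousOn f (Icc a b)) (hm : ν.totalVariation ≤ m) (x y : ℝ)
    (hx : a ≤ x) (hxy : x ≤ y) (hy : y ≤ b) : |f y - f x| ≤ m.real (Ioc x y) := by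
  rw [← hν.apply_Ioc hf hx hxy hy]
  exact (abs_signedMeasure_apply_le ν measurableSet_Ioc).trans
    (ENNReal.toReal_mono (measure_ne_top m _) (hm _))

/-- A null sum `f dk + l dg = 0` of weighted measures makes the corresponding increments
negligible. -/
theorem negligibleOn_of_sInt_add_eq_zero [IsFiniteMeasure m] {k l f g : ℝ → ℝ}
    {νk νg : SignedMeasure ℝ} (hνk : IsLS a b k νk) (hνg : IsLS a b g νg)
    (hk : ContinuousOn k (Icc a b)) (hg : ContinuousOn g (Icc a b))
    (hf : ContinuousOn f (Icc a b)) (hl : ContinuousOn l (Icc a b))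
    (hkm : νk.totalVariation ≤ m) (hgm : νg.totalVariation ≤ m)
    (h : ∀ s, MeasurableSet s → sInt νk f s + sInt νg l s = 0) :
    NegligibleOn a b m fun x y => f x * (k y - k x) + l x * (g y - g x) := by
  refine (((negligibleOn_sInt_sub hνk hk hf).mono hkm).neg.add
    ((negligibleOn_sInt_sub hνg hg hl).mono hgm).neg).congr fun x y _ _ _ => ?_
  linarith [h (Ioc x y) measurableSet_Ioc]

end

/-- The sign of an endpoint value `v` determined by the conserved quantity `c + v * d`. -/
theorem sign_iff_of_mul_inv_eq {v c d e S : ℝ} (hc : 0 < c) (hd : 0 < d) (hS : S ≤ 0)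
    (h : v * c⁻¹ - e⁻¹ = (c + v * d) * S) :
    (0 ≤ v ↔ 0 ≤ (e * c)⁻¹ + S) ∧ (v ≤ 0 ↔ (e * c)⁻¹ + S ≤ 0) := by
  have hpos : 0 < c⁻¹ * (c⁻¹ - d * S) := by
    have : 0 ≤ d * -S := mul_nonneg hd.le (neg_nonneg.2 hS)
    have hc' : 0 < c⁻¹ := inv_pos.2 hc
    exact mul_pos hc' (by linarith)
  have key : (e * c)⁻¹ + S = v * (c⁻¹ * (c⁻¹ - d * S)) := by
    have : c⁻¹ * (v * c⁻¹ - e⁻¹) = c⁻¹ * ((c + v * d) * S) := by rw [h]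
    have hcc : c⁻¹ * c = 1 := inv_mul_cancel₀ hc.ne'
    rw [mul_inv]
    linear_combination -this - S * hcc
  rw [key]
  refine ⟨(mul_nonneg_iff_of_pos_right hpos).symm, ?_⟩
  rw [← not_lt, ← not_lt, mul_pos_iff_of_pos_right hpos]

/-- under (A3) and (A6), for the unique solution `(fm, fp)` of Luckock's
equation one has `fm a ≥ 0 ↔ Λ₋ ≥ 0` and `fp b ≥ 0 ↔ Λ₊ ≥ 0`, and the same
equivalences hold with `≥` replaced by `≤` (hence also with strict inequalities and
with equality).  Here `νip` and `νim` are the Lebesgue-Stieltjes measures of `1/λ₊`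
and `1/λ₋` on `[a,b]`, so that `Λ₋ = 1/(lm a · lm b) − ∫_{Ī} (1/lp) d(1/lm)` and
`Λ₊ = 1/(lp a · lp b) + ∫_{Ī} (1/lm) d(1/lp)`. -/
theorem stmt2 (a b : ℝ) (hab : a < b) (lm lp : ℝ → ℝ)
    (hA3 : A3 a b lm lp) (hA6 : A6 a b lm lp)
    (fm fp : ℝ → ℝ) (hsol : LuckockSol a b lm lp fm fp)
    (νip νim : MeasureTheory.SignedMeasure ℝ)
    (hνip : IsLS a b (fun x => (lp x)⁻¹) νip)
    (hνim : IsLS a b (fun x => (lm x)⁻¹) νim) :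
    (0 ≤ fm a ↔ 0 ≤ (lm a * lm b)⁻¹ - sInt νim (fun x => (lp x)⁻¹) (Set.Icc a b)) ∧
    (0 ≤ fp b ↔ 0 ≤ (lp a * lp b)⁻¹ + sInt νip (fun x => (lm x)⁻¹) (Set.Icc a b)) ∧
    (fm a ≤ 0 ↔ (lm a * lm b)⁻¹ - sInt νim (fun x => (lp x)⁻¹) (Set.Icc a b) ≤ 0) ∧
    (fp b ≤ 0 ↔ (lp a * lp b)⁻¹ + sInt νip (fun x => (lm x)⁻¹) (Set.Icc a b) ≤ 0) := by
  obtain ⟨hlm, hlp, hanti, hmono, -, -⟩ := hA3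
  obtain ⟨hfm, hfp, hbvm, hbvp, hfmb, hfpa, heq⟩ := hsol
  have ha : a ∈ Icc a b := left_mem_Icc.2 hab.le
  have hb : b ∈ Icc a b := right_mem_Icc.2 hab.le
  have hlm₀ : ∀ x ∈ Icc a b, 0 < lm x := fun x hx => hA6.2.trans_le (hanti hx hb hx.2)
  have hlp₀ : ∀ x ∈ Icc a b, 0 < lp x := fun x hx => hA6.1.trans_le (hmono ha hx hx.1)
  have hqm : ContinuousOn (fun x => (lm x)⁻¹) (Icc a b) := hlm.inv₀ fun x hx => (hlm₀ x hx).ne'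
  have hqp : ContinuousOn (fun x => (lp x)⁻¹) (Icc a b) := hlp.inv₀ fun x hx => (hlp₀ x hx).ne'
  have hbvlp : BoundedVariationOn lp (Icc a b) := by
    simpa using hmono.locallyBoundedVariationOn a b ha hb
  have hbvlm : BoundedVariationOn lm (Icc a b) := by
    simpa [Function.comp_def] using LipschitzWith.id.neg.comp_boundedVariationOn
      (hanti.neg.locallyBoundedVariationOn a b ha hb)
  obtain ⟨νlm, hνlm⟩ := exists_isLS hab.le hlm hbvlm
  obtain ⟨νlp, hνlp⟩ := exists_isLS hab.le hlp hbvlp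
  obtain ⟨νfm, hνfm⟩ := exists_isLS hab.le hfm hbvm
  obtain ⟨νfp, hνfp⟩ := exists_isLS hab.le hfp hbvp
  have heqs := heq νlm νlp νfm νfp hνlm hνlp hνfm hνfp
  obtain ⟨m, hm, mlm, mlp, mfm, mfp, mip, mim⟩ : ∃ m : Measure ℝ, IsFiniteMeasure m ∧
      νlm.totalVariation ≤ m ∧ νlp.totalVariation ≤ m ∧ νfm.totalVariation ≤ m ∧
      νfp.totalVariation ≤ m ∧ νip.totalVariation ≤ m ∧ νim.totalVariation ≤ m := by
    refine ⟨νlm.totalVariation + (νlp.totalVariation + (νfm.totalVariation +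
      (νfp.totalVariation + (νip.totalVariation + νim.totalVariation)))), inferInstance,
      ?_, ?_, ?_, ?_, ?_, ?_⟩ <;> intro s <;> simp only [Measure.add_apply]
    · exact le_self_add
    · exact le_add_left le_self_add
    · exact le_add_left (le_add_left le_self_add)
    · exact le_add_left (le_add_left (le_add_left le_self_add))
    · exact le_add_left (le_add_left (le_add_left (le_add_left le_self_add)))
    · exact le_add_left (le_add_left (le_add_left (le_add_left le_add_self)))
  have hEp := negligibleOn_of_sInt_add_eq_zero hνlp hνfp hlp hfp hfm hlm mlp mfp
    fun s hs => (heqs s hs).1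
  have hEm := negligibleOn_of_sInt_add_eq_zero hνlm hνfm hlm hfm hfp hlp mlm mfm
    fun s hs => (heqs s hs).2
  have hlmm := abs_sub_le_of_isLS hνlm hlm mlm
  have hlpm := abs_sub_le_of_isLS hνlp hlp mlp
  have hfmm := abs_sub_le_of_isLS hνfm hfm mfm
  have hfpm := abs_sub_le_of_isLS hνfp hfp mfp
  have hκ : ∀ x ∈ Icc a b, fm x * lp x + fp x * lm x = fm a * lp a + fp a * lm a := by
    intro x hx
    refine NegligibleOn.eq_of_sub (m := m) (F := fun x => fm x * lp x + fp x * lm x)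
      (((hEp.add hEm).add ((negligibleOn_mul_increments hlp hfmm).add
        (negligibleOn_mul_increments hlm hfpm))).congr fun x y _ _ _ => ?_) hx.1 hx.2
    ring
  have hp := div_sub_div_eq_mul_sInt hab.le hlp hlm hfm hlp₀ hlm₀ hlpm hfpm hEp hκ hνip mip
  have hm := div_sub_div_eq_mul_sInt hab.le hlm hlp hfp hlm₀ hlp₀ hlmm hfmm hEm
    (fun x hx => by rw [add_comm, hκ x hx]) hνim mim
  have hSp : sInt νip (fun x => (lm x)⁻¹) (Icc a b) ≤ 0 :=
    sInt_Icc_nonpos hab.le hνip hqp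
      (fun x hx y hy hxy => inv_anti₀ (hlp₀ x hx) (hmono hx hy hxy)) hqm
      fun x hx => (inv_pos.2 (hlm₀ x hx)).le
  have hSm : 0 ≤ sInt νim (fun x => (lp x)⁻¹) (Icc a b) :=
    sInt_Icc_nonneg hab.le hνim hqm
      (fun x hx y hy hxy => inv_anti₀ (hlm₀ y hy) (hanti hx hy hxy)) hqp
      fun x hx => (inv_pos.2 (hlp₀ x hx)).le
  have hκb := hκ b hb
  rw [hfmb, hfpa, one_mul] at hκb
  rw [hfpa] at hp hm
  rw [← hκb, one_mul] at hp
  rw [hfmb] at hm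
  obtain ⟨hp₁, hp₂⟩ := sign_iff_of_mul_inv_eq (hlp₀ b hb) (hlm₀ b hb) hSp hp
  obtain ⟨hm₁, hm₂⟩ := sign_iff_of_mul_inv_eq (v := fm a) (c := lm a) (d := lp a) (e := lm b)
    (hlm₀ a ha) (hlp₀ a ha) (neg_nonpos.2 hSm) (by linear_combination -hm)
  rw [← sub_eq_add_neg, mul_comm (lm b)] at hm₁ hm₂
  exact ⟨hm₁, hp₁, hm₂, hp₂⟩
end
end

section
/- Assume (A3) and (A6). Let g₋ : Ī → ℝ be bounded, left-continuous and of bounded variation, let g₊ : Ī → ℝ be bounded, right-continuous and of bounded variation, and let h₋, h₊ : Ī → ℝ be bounded functions of bounded variation, h₋ left-continuous and h₊ right-continuous, with dh₋ = −λ₋ dg₋ and dh₊ = −λ₊ dg₊. Then a pair (w₋, w₊), with w₋ bounded left-continuous of bounded variation and w₊ bounded right-continuous of bounded variation, satisfies (i) w₊ dλ₊ + d(λ₊ w₋) = −dg₋ and (ii) w₋ dλ₋ + d(λ₋ w₊) = −dg₊ if and only if there exists a constant κ ∈ ℝ such that (a) dw₋ = ((κ + h₊)/λ₋) d(1/λ₊)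 + (1/λ₋) d(h₋/λ₊), (b) dw₊ = ((κ + h₋)/λ₊) d(1/λ₋) + (1/λ₊) d(h₊/λ₋), and (c) w₋ + w₊ = (κ + h₋ + h₊)/(λ₋λ₊) on Ī. Moreover, given (c), equations (a) and (b) imply each other. -/
open MeasureTheory Set
open scoped ENNReal

noncomputable section

open Filter Topology

section BoundedVariation

variable {α : Type*} [LinearOrder α] {s : Set α} {f g : α → ℝ}

lemma BoundedVariationOn.fun_add_real (hf : BoundedVariationOn f s) (hg : BoundedVariationOn g s) :
    BoundedVariationOn (fun x => f x + g x) s := by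
  refine ne_top_of_le_ne_top (ENNReal.add_ne_top.2 ⟨hf, hg⟩) (iSup_le ?_)
  rintro ⟨n, u, hu, hus⟩
  calc ∑ i ∈ Finset.range n, edist (f (u (i + 1)) + g (u (i + 1))) (f (u i) + g (u i))
      ≤ ∑ i ∈ Finset.range n,
          (edist (f (u (i + 1))) (f (u i)) + edist (g (u (i + 1))) (g (u i))) :=
        Finset.sum_le_sum fun i _ => edist_add_add_le _ _ _ _
    _ ≤ eVariationOn f s + eVariationOn g s := by
        rw [Finset.sum_add_distrib]
        exact add_le_add
          (eVariationOn.sum_le_of_monotoneOn_Iic (hu.monotoneOn _) fun i _ => hus i)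
          (eVariationOn.sum_le_of_monotoneOn_Iic (hu.monotoneOn _) fun i _ => hus i)

lemma BoundedVariationOn.const_real (c : ℝ) (s : Set α) :
    BoundedVariationOn (fun _ => c) s :=
  MonotoneOn.boundedVariationOn (C := |c|) (fun _ _ _ _ _ => le_rfl) fun _ _ => le_rfl

lemma BoundedVariationOn.exists_abs_le (hf : BoundedVariationOn f s) :
    ∃ C, ∀ x ∈ s, |f x| ≤ C := by
  rcases s.eq_empty_or_nonempty with rfl | ⟨x₀, hx₀⟩
  · exact ⟨0, by simp⟩
  refine ⟨|f x₀| + (eVariationOn f s).toReal, fun x hx => ?_⟩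
  have h := hf.dist_le hx hx₀
  rw [Real.dist_eq] at h
  have h2 := abs_add_le (f x - f x₀) (f x₀)
  rw [sub_add_cancel] at h2
  linarith

end BoundedVariation

lemma MonotoneOn.boundedVariationOn_Icc {a b : ℝ} {f : ℝ → ℝ} (hf : MonotoneOn f (Icc a b)) :
    BoundedVariationOn f (Icc a b) := by
  refine hf.boundedVariationOn (C := max |f a| |f b|) fun x hx => ?_
  have ha : a ∈ Icc a b := ⟨le_rfl, hx.1.trans hx.2⟩
  have hb : b ∈ Icc a b := ⟨hx.1.trans hx.2, le_rfl⟩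
  exact abs_le_max_abs_abs (hf ha hx hx.1) (hf hx hb hx.2)

lemma AntitoneOn.boundedVariationOn_Icc {a b : ℝ} {f : ℝ → ℝ} (hf : AntitoneOn f (Icc a b)) :
    BoundedVariationOn f (Icc a b) := by
  simpa using (BoundedVariationOn.const_real (-1) (Icc a b)).fun_mul
    (MonotoneOn.boundedVariationOn_Icc hf.neg)

section RightLimits

variable {a b : ℝ} {f g : ℝ → ℝ} {x : ℝ}

lemma inter_Ioi_nhdsWithin (hx : x ∈ Ico a b) : 𝓝[Icc a b ∩ Ioi x] x = 𝓝[>] x := by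
  apply le_antisymm (nhdsWithin_mono _ inter_subset_right)
  have : Icc a b ∈ 𝓝[>] x := mem_of_superset (Ioc_mem_nhdsGT hx.2)
    fun y hy => ⟨hx.1.trans hy.1.le, hy.2⟩
  exact le_inf inf_le_left (le_principal_iff.2 (inter_mem this self_mem_nhdsWithin))

lemma BoundedVariationOn.tendsto_rLim (hf : BoundedVariationOn f (Icc a b)) (hx : x ∈ Ico a b) :
    Tendsto f (𝓝[>] x) (𝓝 (rLim b f x)) := by
  rw [rLim, if_pos hx.2]
  have := hf.exists_tendsto_right x
  rw [inter_Ioi_nhdsWithin hx] at this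
  exact tendsto_rightLim_of_tendsto this

lemma rLim_eq_of_tendsto {y : ℝ} (hx : x < b) (h : Tendsto f (𝓝[>] x) (𝓝 y)) :
    rLim b f x = y := by
  rw [rLim, if_pos hx, rightLim_eq_of_tendsto h]

lemma rLim_self (b : ℝ) (f : ℝ → ℝ) : rLim b f b = f b := by simp [rLim]

lemma rLim_congr (h : EqOn f g (Icc a b)) (hf : BoundedVariationOn f (Icc a b))
    (hx : x ∈ Icc a b) : rLim b g x = rLim b f x := by
  rcases hx.2.eq_or_lt with rfl | hxb
  · rw [rLim_self, rLim_self, h hx]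
  · refine rLim_eq_of_tendsto hxb ((hf.tendsto_rLim ⟨hx.1, hxb⟩).congr' ?_)
    filter_upwards [Ioc_mem_nhdsGT hxb] with y hy
    exact h ⟨hx.1.trans hy.1.le, hy.2⟩

lemma rLim_add (hf : BoundedVariationOn f (Icc a b)) (hg : BoundedVariationOn g (Icc a b))
    (hx : x ∈ Icc a b) : rLim b (fun y => f y + g y) x = rLim b f x + rLim b g x := by
  rcases hx.2.eq_or_lt with rfl | hxb
  · simp only [rLim_self]
  · exact rLim_eq_of_tendsto hxb
      ((hf.tendsto_rLim ⟨hx.1, hxb⟩).add (hg.tendsto_rLim ⟨hx.1, hxb⟩))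

lemma rLim_mul (hf : BoundedVariationOn f (Icc a b)) (hg : BoundedVariationOn g (Icc a b))
    (hx : x ∈ Icc a b) : rLim b (fun y => f y * g y) x = rLim b f x * rLim b g x := by
  rcases hx.2.eq_or_lt with rfl | hxb
  · simp only [rLim_self]
  · exact rLim_eq_of_tendsto hxb
      ((hf.tendsto_rLim ⟨hx.1, hxb⟩).mul (hg.tendsto_rLim ⟨hx.1, hxb⟩))

lemma rLim_const (b c x : ℝ) : rLim b (fun _ => c) x = c := by
  rcases lt_or_ge x b with hxb | hxb
  · exact rLim_eq_of_tendsto hxb tendsto_const_nhds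
  · rw [rLim, if_neg hxb.not_gt]

lemma rLim_eq_self (h : ∀ x ∈ Ico a b, ContinuousWithinAt f (Ioi x) x) (hx : x ∈ Icc a b) :
    rLim b f x = f x := by
  rcases hx.2.eq_or_lt with rfl | hxb
  · exact rLim_self _ _
  · exact rLim_eq_of_tendsto hxb (h x ⟨hx.1, hxb⟩)

lemma ContinuousOn.rLim_eq (h : ContinuousOn f (Icc a b)) (hx : x ∈ Icc a b) :
    rLim b f x = f x := by
  refine rLim_eq_self (fun y hy => ?_) hx
  have := (h y ⟨hy.1, hy.2.le⟩).mono (inter_subset_left (t := Ioi y))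
  rwa [ContinuousWithinAt, inter_Ioi_nhdsWithin hy] at this

lemma ContinuousOn.continuousWithinAt_Iio (h : ContinuousOn f (Icc a b)) (hx : x ∈ Ioc a b) :
    ContinuousWithinAt f (Iio x) x := by
  have h1 : 𝓝[Icc a b ∩ Iio x] x = 𝓝[<] x := by
    apply le_antisymm (nhdsWithin_mono _ inter_subset_right)
    have : Icc a b ∈ 𝓝[<] x := mem_of_superset (Ico_mem_nhdsLT hx.1)
      fun y hy => ⟨hy.1, hy.2.le.trans hx.2⟩
    exact le_inf inf_le_left (le_principal_iff.2 (inter_mem this self_mem_nhdsWithin))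
  have := (h x ⟨hx.1.le, hx.2⟩).mono (inter_subset_left (t := Iio x))
  rwa [ContinuousWithinAt, h1] at this

lemma BoundedVariationOn.tendsto_rLim_left (hf : BoundedVariationOn f (Icc a b))
    (hx : x ∈ Ioc a b) (hc : ContinuousWithinAt f (Iio x) x) :
    Tendsto (rLim b f) (𝓝[<] x) (𝓝 (f x)) := by
  refine (closed_nhds_basis (f x)).tendsto_right_iff.2 fun s ⟨hs, hsc⟩ => ?_
  obtain ⟨z, hz, hzs⟩ := (mem_nhdsLT_iff_exists_Ioo_subset' hx.1).1 (hc hs)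
  have hz' : max a z < x := max_lt hx.1 hz
  filter_upwards [Ioo_mem_nhdsLT hz'] with y hy
  have hya : a < y := (le_max_left _ _).trans_lt hy.1
  refine hsc.mem_of_tendsto (hf.tendsto_rLim ⟨hya.le, hy.2.trans_le hx.2⟩) ?_
  filter_upwards [Ioo_mem_nhdsGT hy.2] with t ht
  exact hzs ⟨((le_max_right a z).trans_lt hy.1).trans ht.1, ht.2⟩

lemma BoundedVariationOn.countable_rLim_ne (hf : BoundedVariationOn f (Icc a b)) :
    {x ∈ Icc a b | rLim b f x ≠ f x}.Countable := by
  obtain ⟨p, q, hp, hq, rfl⟩ := hf.locallyBoundedVariationOn.exists_monotoneOn_sub_monotoneOn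
  refine (hp.countable_not_continuousWithinAt.union hq.countable_not_continuousWithinAt).mono ?_
  rintro x ⟨hx, hne⟩
  by_contra hcon
  simp only [mem_union, mem_ofPred_eq, not_or, not_and, not_not] at hcon
  apply hne
  rcases hx.2.eq_or_lt with rfl | hxb
  · exact rLim_self _ _
  have := ((hcon.1 hx).sub (hcon.2 hx)).mono (inter_subset_left (t := Ioi x))
  rw [ContinuousWithinAt, inter_Ioi_nhdsWithin ⟨hx.1, hxb⟩] at this
  exact rLim_eq_of_tendsto hxb this

lemma BoundedVariationOn.aestronglyMeasurable {μ : Measure ℝ} (hμ : μ (Icc a b)ᶜ = 0)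
    (hf : BoundedVariationOn f (Icc a b)) : AEStronglyMeasurable f μ := by
  have hμ' : μ.restrict (Icc a b) = μ :=
    Measure.restrict_eq_self_of_ae_mem (mem_ae_iff.2 hμ)
  obtain ⟨p, q, hp, hq, rfl⟩ := hf.locallyBoundedVariationOn.exists_monotoneOn_sub_monotoneOn
  rw [← hμ']
  exact ((aemeasurable_restrict_of_monotoneOn measurableSet_Icc hp).sub
    (aemeasurable_restrict_of_monotoneOn measurableSet_Icc hq)).aestronglyMeasurable

lemma BoundedVariationOn.integrable_mul {μ : Measure ℝ} (hμ : μ (Icc a b)ᶜ = 0)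
    (hf : BoundedVariationOn f (Icc a b)) (hg : Integrable g μ) :
    Integrable (fun x => f x * g x) μ := by
  obtain ⟨C, hC⟩ := hf.exists_abs_le
  refine hg.bdd_mul (c := C) (hf.aestronglyMeasurable hμ) ?_
  filter_upwards [mem_ae_iff.2 hμ] with x hx using hC x hx

end RightLimits

/-- `f` has bounded variation on `[a,b]` and its Lebesgue-Stieltjes signed measure on `[a,b]` has
the density `d` with respect to `μ`. -/
structure HasStieltjesDensity (a b : ℝ) (μ : Measure ℝ) (f d : ℝ → ℝ) : Prop where
  bv : BoundedVariationOn f (Icc a b)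
  integrable : Integrable d μ
  setIntegral_Ioc : ∀ x y : ℝ, a ≤ x → x ≤ y → y ≤ b →
    ∫ t in Ioc x y, d t ∂μ = rLim b f y - rLim b f x
  setIntegral_left : ∫ t in {a}, d t ∂μ = rLim b f a - f a

namespace HasStieltjesDensity

variable {a b : ℝ} {μ : Measure ℝ} {f g d e : ℝ → ℝ} {x : ℝ}

lemma congr_fun (hf : HasStieltjesDensity a b μ f d) (h : EqOn f g (Icc a b)) (hab : a ≤ b)
    (hg : BoundedVariationOn g (Icc a b)) : HasStieltjesDensity a b μ g d where
  bv := hg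
  integrable := hf.integrable
  setIntegral_Ioc x y hax hxy hyb := by
    rw [hf.setIntegral_Ioc x y hax hxy hyb, rLim_congr h hf.bv ⟨hax, hxy.trans hyb⟩,
      rLim_congr h hf.bv ⟨hax.trans hxy, hyb⟩]
  setIntegral_left := by
    rw [hf.setIntegral_left, rLim_congr h hf.bv ⟨le_rfl, hab⟩, h ⟨le_rfl, hab⟩]

lemma const (a b c : ℝ) (μ : Measure ℝ) : HasStieltjesDensity a b μ (fun _ => c) 0 where
  bv := .const_real c _
  integrable := integrable_zero _ _ _
  setIntegral_Ioc x y _ _ _ := by simp [rLim_const]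
  setIntegral_left := by simp [rLim_const]

lemma add (hf : HasStieltjesDensity a b μ f d) (hg : HasStieltjesDensity a b μ g e)
    (hab : a ≤ b) :
    HasStieltjesDensity a b μ (fun x => f x + g x) (fun x => d x + e x) where
  bv := hf.bv.fun_add_real hg.bv
  integrable := hf.integrable.add hg.integrable
  setIntegral_Ioc x y hax hxy hyb := by
    rw [integral_add hf.integrable.integrableOn hg.integrable.integrableOn,
      hf.setIntegral_Ioc x y hax hxy hyb, hg.setIntegral_Ioc x y hax hxy hyb,
      rLim_add hf.bv hg.bv ⟨hax, hxy.trans hyb⟩, rLim_add hf.bv hg.bv ⟨hax.trans hxy, hyb⟩]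
    ring
  setIntegral_left := by
    rw [integral_add hf.integrable.integrableOn hg.integrable.integrableOn,
      hf.setIntegral_left, hg.setIntegral_left, rLim_add hf.bv hg.bv ⟨le_rfl, hab⟩]
    ring

/-- A function is determined by its Stieltjes density up to a constant. -/
lemma exists_rLim_eq_const_add (hf : HasStieltjesDensity a b μ f d)
    (hg : HasStieltjesDensity a b μ g e) (h : d =ᵐ[μ] e) :
    ∃ κ, ∀ x ∈ Icc a b, rLim b f x = κ + rLim b g x := by
  refine ⟨rLim b f a - rLim b g a, fun x hx => ?_⟩
  have h1 := hf.setIntegral_Ioc a x le_rfl hx.1 hx.2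
  have h2 := hg.setIntegral_Ioc a x le_rfl hx.1 hx.2
  rw [integral_congr_ae (ae_restrict_of_ae h), h2] at h1
  linarith

/-- The Stieltjes density is unique. -/
lemma ae_eq (hμ : μ (Icc a b)ᶜ = 0) (hab : a ≤ b) (hf : HasStieltjesDensity a b μ f d)
    (hg : HasStieltjesDensity a b μ f e) : d =ᵐ[μ] e := by
  have hsplit : ∀ k : ℝ → ℝ, Integrable k μ → ∀ s, MeasurableSet s →
      ∫ t in s, k t ∂μ = ∫ t in s ∩ Icc a b, k t ∂μ := fun k hk s hs => by
    rw [← setIntegral_congr_set (s := s ∩ Icc a b) (t := s)]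
    exact inter_ae_eq_left_of_ae_eq_univ (ae_eq_univ.2 hμ)
  have hIoc : ∀ k m : ℝ → ℝ, HasStieltjesDensity a b μ f k → HasStieltjesDensity a b μ f m →
      ∀ x y, x ≤ y → ∫ t in Ioc x y, k t ∂μ = ∫ t in Ioc x y, m t ∂μ := by
    intro k m hk hm x y hxy
    have hd : Disjoint ({a} : Set ℝ) (Ioc a b) := by simp
    rw [hsplit k hk.integrable _ measurableSet_Ioc, hsplit m hm.integrable _ measurableSet_Ioc]
    rcases lt_or_ge y a with hya | hay
    · have : Ioc x y ∩ Icc a b = ∅ := by ext t; simp; intros; linarith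
      simp [this]
    rcases lt_or_ge b x with hbx | hxb
    · have : Ioc x y ∩ Icc a b = ∅ := by ext t; simp; intros; linarith
      simp [this]
    have hmin : min y b ≤ b := min_le_right _ _
    rcases lt_or_ge x a with hxa | hax
    · have : Ioc x y ∩ Icc a b = {a} ∪ Ioc a (min y b) := by
        ext t
        simp only [mem_inter_iff, mem_Ioc, mem_Icc, mem_union, mem_singleton_iff, le_min_iff]
        constructor
        · rintro ⟨⟨_, h1⟩, h2, h3⟩
          rcases h2.eq_or_lt with h | h
          · exact .inl h.symm
          · exact .inr ⟨h, h1, h3⟩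
        · rintro (rfl | ⟨h1, h2, h3⟩)
          · exact ⟨⟨hxa, hay⟩, le_rfl, hab⟩
          · exact ⟨⟨hxa.trans h1, h2⟩, h1.le, h3⟩
      rw [this, setIntegral_union (by simp) measurableSet_Ioc hk.integrable.integrableOn
        hk.integrable.integrableOn, setIntegral_union (by simp) measurableSet_Ioc
        hm.integrable.integrableOn hm.integrable.integrableOn,
        hk.setIntegral_left, hm.setIntegral_left,
        hk.setIntegral_Ioc _ _ le_rfl (le_min hay hab) hmin,
        hm.setIntegral_Ioc _ _ le_rfl (le_min hay hab) hmin]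
    · have : Ioc x y ∩ Icc a b = Ioc x (min y b) := by
        ext t
        simp only [mem_inter_iff, mem_Ioc, mem_Icc, le_min_iff]
        constructor
        · rintro ⟨⟨h0, h1⟩, h2, h3⟩
          exact ⟨h0, h1, h3⟩
        · rintro ⟨h1, h2, h3⟩
          exact ⟨⟨h1, h2⟩, hax.trans h1.le, h3⟩
      rw [this, hk.setIntegral_Ioc _ _ hax (le_min hxy hxb) hmin,
        hm.setIntegral_Ioc _ _ hax (le_min hxy hxb) hmin]
  have key : μ.withDensityᵥ d = μ.withDensityᵥ e := by
    refine VectorMeasure.ext_of_generateFrom {S : Set ℝ | ∃ l u, l ≤ u ∧ Ioc l u = S} ?_ ?_ ?_ ?_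
    · rintro _ ⟨l, u, hlu, rfl⟩
      rw [withDensityᵥ_apply hf.integrable measurableSet_Ioc,
        withDensityᵥ_apply hg.integrable measurableSet_Ioc, hIoc d e hf hg l u hlu]
    · rw [← borel_eq_generateFrom_Ioc_le]
      exact BorelSpace.measurable_eq
    · rintro _ ⟨l, u, hlu, rfl⟩ _ ⟨l', u', hlu', rfl⟩ hne
      rw [Ioc_inter_Ioc] at hne ⊢
      exact ⟨_, _, (nonempty_Ioc.1 hne).le, rfl⟩
    · rw [withDensityᵥ_apply hf.integrable .univ, withDensityᵥ_apply hg.integrable .univ,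
        hsplit d hf.integrable _ .univ, hsplit e hg.integrable _ .univ]
      have : univ ∩ Icc a b = Ioc (a - 1) b ∩ Icc a b := by
        ext t
        simp only [mem_inter_iff, mem_univ, true_and, mem_Icc, mem_Ioc]
        constructor
        · rintro ⟨h1, h2⟩
          exact ⟨⟨by linarith, h2⟩, h1, h2⟩
        · exact fun h => h.2
      rw [this, ← hsplit d hf.integrable _ measurableSet_Ioc,
        ← hsplit e hg.integrable _ measurableSet_Ioc]
      exact hIoc d e hf hg _ _ (by linarith)
  exact hf.integrable.ae_eq_of_withDensityᵥ_eq hg.integrable key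

/-- The atom at a point of left continuity is the jump to the right limit. -/
lemma setIntegral_singleton (hf : HasStieltjesDensity a b μ f d)
    (hc : ∀ x ∈ Ioc a b, ContinuousWithinAt f (Iio x) x) (hx : x ∈ Icc a b) :
    ∫ t in {x}, d t ∂μ = rLim b f x - f x := by
  rcases hx.1.eq_or_lt with rfl | hax
  · exact hf.setIntegral_left
  obtain ⟨u, hu, hux, hlim⟩ := exists_seq_strictMono_tendsto' hax
  have hlim' : Tendsto u atTop (𝓝[<] x) :=
    tendsto_nhdsWithin_iff.2 ⟨hlim, .of_forall fun n => (hux n).2⟩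
  have h1 : Tendsto (fun n => ∫ t in Ioc (u n) x, d t ∂μ) atTop (𝓝 (rLim b f x - f x)) := by
    have := ((hf.bv.tendsto_rLim_left ⟨hax, hx.2⟩ (hc x ⟨hax, hx.2⟩)).comp hlim').const_sub
      (rLim b f x)
    refine this.congr fun n => ?_
    rw [hf.setIntegral_Ioc _ _ (hux n).1.le (hux n).2.le hx.2, Function.comp]
  have h2 : Tendsto (fun n => ∫ t in Ioc (u n) x, d t ∂μ) atTop
      (𝓝 (∫ t in ⋂ n, Ioc (u n) x, d t ∂μ)) :=
    tendsto_setIntegral_of_antitone (fun n => measurableSet_Ioc)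
      (fun i j hij => Ioc_subset_Ioc_left (hu.monotone hij)) ⟨0, hf.integrable.integrableOn⟩
  have h3 : ⋂ n, Ioc (u n) x = {x} := by
    ext t
    simp only [mem_iInter, mem_Ioc, mem_singleton_iff]
    constructor
    · exact fun h => le_antisymm (h 0).2 (le_of_tendsto' hlim fun n => (h n).1.le)
    · rintro rfl n
      exact ⟨(hux n).2, le_rfl⟩
  rw [h3] at h2
  exact tendsto_nhds_unique h2 h1

lemma setIntegral_singleton_eq_zero (hf : HasStieltjesDensity a b μ f d)
    (hc : ContinuousOn f (Icc a b)) (hx : x ∈ Icc a b) : ∫ t in {x}, d t ∂μ = 0 := by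
  rw [hf.setIntegral_singleton (fun y hy => hc.continuousWithinAt_Iio hy) hx, hc.rLim_eq hx,
    sub_self]

/-- The density of a continuous function does not see the jumps of a function of bounded
variation. -/
lemma rLim_mul_ae_eq (hμ : μ (Icc a b)ᶜ = 0) (hd : HasStieltjesDensity a b μ f d)
    (hc : ContinuousOn f (Icc a b)) (hg : BoundedVariationOn g (Icc a b)) :
    ∀ᵐ x ∂μ, rLim b g x * d x = g x * d x := by
  have hcount := hg.countable_rLim_ne
  have hS : μ {x ∈ {x ∈ Icc a b | rLim b g x ≠ g x} | d x ≠ 0} = 0 := by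
    rw [← biUnion_of_singleton {x ∈ {x ∈ Icc a b | rLim b g x ≠ g x} | d x ≠ 0},
      measure_biUnion_null_iff (hcount.mono fun x hx => hx.1)]
    rintro x ⟨⟨hx, -⟩, hdx⟩
    have h := hd.setIntegral_singleton_eq_zero hc hx
    rw [integral_singleton, smul_eq_mul, mul_eq_zero, or_iff_left hdx, measureReal_def,
      ENNReal.toReal_eq_zero_iff] at h
    refine h.resolve_right fun htop => ?_
    have := hd.integrable.measure_norm_ge_lt_top (ε := ‖d x‖) (norm_pos_iff.2 hdx)
    exact (this.trans_le' (measure_mono (singleton_subset_iff.2 (by simp)))).ne htop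
  filter_upwards [mem_ae_iff.2 hμ, measure_eq_zero_iff_ae_notMem.1 hS] with x hx hxS
  by_cases h : d x = 0
  · simp [h]
  · by_cases h' : rLim b g x = g x
    · rw [h']
    · exact absurd ⟨⟨hx, h'⟩, h⟩ hxS

end HasStieltjesDensity

namespace HasStieltjesDensity

variable {a b : ℝ} {μ : Measure ℝ} {f l f' l' : ℝ → ℝ} {x y : ℝ}

lemma setIntegral_Icc_of_continuousOn (hl : HasStieltjesDensity a b μ l l')
    (hc : ContinuousOn l (Icc a b)) (hx : a ≤ x) (hxy : x ≤ y) (hy : y ≤ b) :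
    ∫ t in Icc x y, l' t ∂μ = l y - l x := by
  have hxm : x ∈ Icc a b := ⟨hx, hxy.trans hy⟩
  rw [← Icc_union_Ioc_eq_Icc le_rfl hxy, Icc_self,
    setIntegral_union (by simp) measurableSet_Ioc hl.integrable.integrableOn
      hl.integrable.integrableOn, hl.setIntegral_singleton_eq_zero hc hxm,
    hl.setIntegral_Ioc x y hx hxy hy, hc.rLim_eq hxm, hc.rLim_eq ⟨hx.trans hxy, hy⟩, zero_add]

/-- Integration by parts when one of the factors is continuous. -/
lemma setIntegral_Ioc_mul [IsFiniteMeasure μ] (hμ : μ (Icc a b)ᶜ = 0)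
    (hl : HasStieltjesDensity a b μ l l') (hc : ContinuousOn l (Icc a b))
    (hf : HasStieltjesDensity a b μ f f') (hx : a ≤ x) (hxy : x ≤ y) (hy : y ≤ b) :
    ∫ t in Ioc x y, (l t * f' t + f t * l' t) ∂μ = l y * rLim b f y - l x * rLim b f x := by
  have hint1 : Integrable (fun t => l t * f' t) (μ.restrict (Ioc x y)) :=
    (hl.bv.integrable_mul hμ hf.integrable).restrict
  have hint2 : Integrable (fun t => rLim b f t * l' t) (μ.restrict (Ioc x y)) :=
    ((hf.bv.integrable_mul hμ hl.integrable).congr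
      ((hl.rLim_mul_ae_eq hμ hc hf.bv).mono fun t ht => ht.symm)).restrict
  have hf' : Integrable f' (μ.restrict (Ioc x y)) := hf.integrable.restrict
  have hl' : Integrable l' (μ.restrict (Ioc x y)) := hl.integrable.restrict
  have hxm : x ∈ Icc a b := ⟨hx, hxy.trans hy⟩
  have hym : y ∈ Icc a b := ⟨hx.trans hxy, hy⟩
  have hswap := integral_integral_swap (μ := μ.restrict (Ioc x y)) (ν := μ.restrict (Ioc x y))
    (f := fun s t => {p : ℝ × ℝ | p.1 ≤ p.2}.indicator (fun p => f' p.1 * l' p.2) (s, t))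
    ((hf'.mul_prod hl').indicator (measurableSet_le measurable_fst measurable_snd))
  have hleft : ∀ s ∈ Ioc x y, ∫ t in Ioc x y,
      {p : ℝ × ℝ | p.1 ≤ p.2}.indicator (fun p => f' p.1 * l' p.2) (s, t) ∂μ
        = f' s * l y - l s * f' s := by
    intro s hs
    calc _ = ∫ t in Ioc x y, (Ici s).indicator (fun t => f' s * l' t) t ∂μ := by
          simp only [indicator, mem_ofPred_eq, mem_Ici]
      _ = f' s * ∫ t in Icc s y, l' t ∂μ := by
          rw [setIntegral_indicator measurableSet_Ici, ← integral_const_mul]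
          congr 2
          ext t
          simp only [mem_inter_iff, mem_Ioc, mem_Ici, mem_Icc]
          exact ⟨fun h => ⟨h.2, h.1.2⟩, fun h => ⟨⟨hs.1.trans_le h.1, h.2⟩, h.1⟩⟩
      _ = f' s * l y - l s * f' s := by
          rw [hl.setIntegral_Icc_of_continuousOn hc (hx.trans hs.1.le) hs.2 hy]
          ring
  have hright : ∀ t ∈ Ioc x y, ∫ s in Ioc x y,
      {p : ℝ × ℝ | p.1 ≤ p.2}.indicator (fun p => f' p.1 * l' p.2) (s, t) ∂μ
        = rLim b f t * l' t - rLim b f x * l' t := by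
    intro t ht
    calc _ = ∫ s in Ioc x y, (Iic t).indicator (fun s => f' s * l' t) s ∂μ := by
          simp only [indicator, mem_ofPred_eq, mem_Iic]
      _ = (∫ s in Ioc x t, f' s ∂μ) * l' t := by
          rw [setIntegral_indicator measurableSet_Iic, ← integral_mul_const]
          congr 2
          ext s
          simp only [mem_inter_iff, mem_Ioc, mem_Iic]
          exact ⟨fun h => ⟨h.1.1, h.2⟩, fun h => ⟨⟨h.1, h.2.trans ht.2⟩, h.2⟩⟩
      _ = rLim b f t * l' t - rLim b f x * l' t := by
          rw [hf.setIntegral_Ioc x t hx ht.1.le (ht.2.trans hy)]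
          ring
  rw [setIntegral_congr_fun measurableSet_Ioc hleft,
    setIntegral_congr_fun measurableSet_Ioc hright, integral_sub (hf'.mul_const _) hint1,
    integral_sub hint2 (hl'.const_mul _), integral_mul_const, integral_const_mul,
    hf.setIntegral_Ioc x y hx hxy hy, hl.setIntegral_Ioc x y hx hxy hy, hc.rLim_eq hxm,
    hc.rLim_eq hym,
    integral_congr_ae (ae_restrict_of_ae (hl.rLim_mul_ae_eq hμ hc hf.bv))] at hswap
  rw [integral_add hint1 (hf.bv.integrable_mul hμ hl.integrable).restrict]
  linarith

/-- Product rule when one of the factors is continuous. -/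
lemma mul [IsFiniteMeasure μ] (hμ : μ (Icc a b)ᶜ = 0) (hab : a ≤ b)
    (hl : HasStieltjesDensity a b μ l l') (hc : ContinuousOn l (Icc a b))
    (hf : HasStieltjesDensity a b μ f f') :
    HasStieltjesDensity a b μ (fun x => l x * f x) (fun x => l x * f' x + f x * l' x) where
  bv := hl.bv.fun_mul hf.bv
  integrable := (hl.bv.integrable_mul hμ hf.integrable).add
    (hf.bv.integrable_mul hμ hl.integrable)
  setIntegral_Ioc x y hx hxy hy := by
    have hxm : x ∈ Icc a b := ⟨hx, hxy.trans hy⟩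
    have hym : y ∈ Icc a b := ⟨hx.trans hxy, hy⟩
    rw [hl.setIntegral_Ioc_mul hμ hc hf hx hxy hy, rLim_mul hl.bv hf.bv hxm,
      rLim_mul hl.bv hf.bv hym, hc.rLim_eq hxm, hc.rLim_eq hym]
  setIntegral_left := by
    have ham : a ∈ Icc a b := ⟨le_rfl, hab⟩
    have h1 := hl.setIntegral_singleton_eq_zero hc ham
    have h2 := hf.setIntegral_left
    rw [integral_singleton, smul_eq_mul] at h1 h2 ⊢
    rw [rLim_mul hl.bv hf.bv ham, hc.rLim_eq ham]
    linear_combination f a * h1 + l a * h2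

end HasStieltjesDensity

namespace MeasureTheory.SignedMeasure

variable {a b : ℝ} {μ : Measure ℝ} {ν : SignedMeasure ℝ} {f g : ℝ → ℝ} {s : Set ℝ}

lemma totalVariation_compl_eq_zero {t : Set ℝ} (ht : MeasurableSet t)
    (h : ∀ s : Set ℝ, MeasurableSet s → s ∩ t = ∅ → ν s = 0) : ν.totalVariation tᶜ = 0 := by
  obtain ⟨i, hi₁, hi₂, hi₃, hpos, hneg⟩ := ν.toJordanDecomposition_spec
  have key : ∀ j : Set ℝ, MeasurableSet j → ν (j ∩ tᶜ) = 0 := fun j hj =>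
    h _ (hj.inter ht.compl) (by rw [inter_assoc, compl_inter_self, inter_empty])
  have hp : ν.toJordanDecomposition.posPart.real tᶜ = 0 := by
    rw [hpos, toMeasureOfZeroLE_real_apply _ _ _ ht.compl, key i hi₁]
  have hn : ν.toJordanDecomposition.negPart.real tᶜ = 0 := by
    rw [hneg, toMeasureOfLEZero_real_apply _ _ _ ht.compl, key iᶜ hi₁.compl, neg_zero]
  rw [measureReal_eq_zero_iff] at hp hn
  rw [totalVariation, Measure.add_apply, hp, hn, add_zero]

/-- The density of a signed measure with respect to a measure dominating it. -/
def density (ν : SignedMeasure ℝ) (μ : Measure ℝ) (x : ℝ) : ℝ :=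
  (ν.toJordanDecomposition.posPart.rnDeriv μ x).toReal -
    (ν.toJordanDecomposition.negPart.rnDeriv μ x).toReal

lemma integrable_density (ν : SignedMeasure ℝ) (μ : Measure ℝ) :
    Integrable (ν.density μ) μ :=
  Measure.integrable_toReal_rnDeriv.sub Measure.integrable_toReal_rnDeriv

lemma setIntegral_density [IsFiniteMeasure μ] (h : ν.totalVariation ≪ μ) (hs : MeasurableSet s) :
    ∫ x in s, ν.density μ x ∂μ = ν s := by
  obtain ⟨hp, hn⟩ := (ν.totalVariation_absolutelyContinuous_iff μ).1 h
  simp only [density]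
  rw [integral_sub Measure.integrable_toReal_rnDeriv.integrableOn
    Measure.integrable_toReal_rnDeriv.integrableOn, Measure.setIntegral_toReal_rnDeriv hp,
    Measure.setIntegral_toReal_rnDeriv hn, ν.apply_eq_posPart_real_sub_negPart_real hs]

lemma sInt_eq_setIntegral [IsFiniteMeasure μ] (h : ν.totalVariation ≪ μ)
    (hμ : μ (Icc a b)ᶜ = 0) (hg : BoundedVariationOn g (Icc a b)) (s : Set ℝ) :
    sInt ν g s = ∫ x in s, g x * ν.density μ x ∂μ := by
  obtain ⟨hp, hn⟩ := (ν.totalVariation_absolutelyContinuous_iff μ).1 h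
  rw [sInt, ← setIntegral_rnDeriv_smul' hp, ← setIntegral_rnDeriv_smul' hn, ← integral_sub]
  · simp only [density, smul_eq_mul]
    congr 1 with x
    ring
  all_goals
    simp only [smul_eq_mul, mul_comm _ (g _)]
    exact (hg.integrable_mul hμ Measure.integrable_toReal_rnDeriv).integrableOn

lemma hasStieltjesDensity [IsFiniteMeasure μ] (h : ν.totalVariation ≪ μ)
    (hf : BoundedVariationOn f (Icc a b)) (hν : IsLS a b f ν) :
    HasStieltjesDensity a b μ f (ν.density μ) where
  bv := hf
  integrable := ν.integrable_density μ
  setIntegral_Ioc x y hx hxy hy := by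
    rw [setIntegral_density h measurableSet_Ioc, hν.2.1 x y hx hxy hy]
  setIntegral_left := by
    rw [setIntegral_density h (measurableSet_singleton a), hν.2.2]

lemma exists_dominating {t : Set ℝ} (ht : MeasurableSet t) (l : List (SignedMeasure ℝ))
    (h : ∀ ν ∈ l, ∀ s : Set ℝ, MeasurableSet s → s ∩ t = ∅ → ν s = 0) :
    ∃ μ : Measure ℝ, IsFiniteMeasure μ ∧ μ tᶜ = 0 ∧ ∀ ν ∈ l, ν.totalVariation ≪ μ := by
  induction l with
  | nil => exact ⟨0, inferInstance, by simp, by simp⟩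
  | cons ν l ih =>
    obtain ⟨μ, _, hμ, hl⟩ := ih fun ν' hν' => h ν' (List.mem_cons_of_mem _ hν')
    have : IsFiniteMeasure ν.totalVariation := by
      unfold totalVariation
      infer_instance
    refine ⟨ν.totalVariation + μ, inferInstance, ?_, ?_⟩
    · rw [Measure.add_apply, hμ, totalVariation_compl_eq_zero ht (h ν List.mem_cons_self),
        add_zero]
    · intro ν' hν'
      rcases List.mem_cons.1 hν' with rfl | hν'
      · exact Measure.AbsolutelyContinuous.rfl.add_right _
      · exact (hl ν' hν').trans (by
          rw [add_comm]
          exact Measure.AbsolutelyContinuous.rfl.add_right _)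

end MeasureTheory.SignedMeasure

lemma forall_setIntegral_eq_iff {μ : Measure ℝ} {d e : ℝ → ℝ} (hd : Integrable d μ)
    (he : Integrable e μ) :
    (∀ s, MeasurableSet s → ∫ x in s, d x ∂μ = ∫ x in s, e x ∂μ) ↔ d =ᵐ[μ] e :=
  ⟨fun h => Integrable.ae_eq_of_forall_setIntegral_eq _ _ hd he fun s hs _ => h s hs,
    fun h _ _ => integral_congr_ae (ae_restrict_of_ae h)⟩

namespace HasStieltjesDensity

variable {a b : ℝ} {μ : Measure ℝ} [IsFiniteMeasure μ]
  {p m h k u v p' m' i' h' k' u' g' e' q' pu' mv' : ℝ → ℝ} {κ : ℝ}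

lemma ae_eq_mul (hμ : μ (Icc a b)ᶜ = 0) (hab : a ≤ b) (hp : HasStieltjesDensity a b μ p p')
    (hpc : ContinuousOn p (Icc a b)) (hu : HasStieltjesDensity a b μ u u')
    (hpu : HasStieltjesDensity a b μ (fun x => p x * u x) pu') :
    ∀ᵐ x ∂μ, pu' x = p x * u' x + u x * p' x :=
  hpu.ae_eq hμ hab (hp.mul hμ hab hpc hu)

lemma ae_inv_eq (hμ : μ (Icc a b)ᶜ = 0) (hab : a ≤ b) (hp : HasStieltjesDensity a b μ p p')
    (hpc : ContinuousOn p (Icc a b)) (hp0 : ∀ x ∈ Icc a b, 0 < p x)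
    (hi : HasStieltjesDensity a b μ (fun x => (p x)⁻¹) i') :
    ∀ᵐ x ∂μ, 0 = p x * i' x + (p x)⁻¹ * p' x := by
  refine (HasStieltjesDensity.const a b 1 μ).ae_eq hμ hab
    ((hp.mul hμ hab hpc hi).congr_fun (fun x hx => ?_) hab (.const_real 1 _))
  exact mul_inv_cancel₀ (ne_of_gt (hp0 x hx))

/-- Under the algebraic identity for `u + v`, the equation for `p u` is equivalent to the
equation for `u`. -/
lemma ae_equation_iff (hμ : μ (Icc a b)ᶜ = 0) (hab : a ≤ b)
    (hp : HasStieltjesDensity a b μ p p') (hpc : ContinuousOn p (Icc a b))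
    (hp0 : ∀ x ∈ Icc a b, 0 < p x) (hm0 : ∀ x ∈ Icc a b, 0 < m x)
    (hi : HasStieltjesDensity a b μ (fun x => (p x)⁻¹) i')
    (hh : HasStieltjesDensity a b μ h h') (hu : HasStieltjesDensity a b μ u u')
    (hpu : HasStieltjesDensity a b μ (fun x => p x * u x) pu')
    (hq : HasStieltjesDensity a b μ (fun x => h x / p x) q')
    (hg : ∀ᵐ x ∂μ, h' x = -(m x * g' x))
    (hsum : ∀ x ∈ Icc a b, u x + v x = (κ + h x + k x) / (m x * p x)) :
    (∀ᵐ x ∂μ, v x * p' x + pu' x = -g' x) ↔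
      ∀ᵐ x ∂μ, u' x = (κ + k x) / m x * i' x + (m x)⁻¹ * q' x := by
  have hic : ContinuousOn (fun x => (p x)⁻¹) (Icc a b) := hpc.inv₀ fun x hx => (hp0 x hx).ne'
  have hq' : HasStieltjesDensity a b μ (fun x => (p x)⁻¹ * h x) q' := by
    simpa only [div_eq_inv_mul] using hq
  have e3 := hi.ae_eq_mul hμ hab hic hh hq'
  refine eventually_congr ?_
  filter_upwards [mem_ae_iff.2 hμ, hp.ae_eq_mul hμ hab hpc hu hpu,
    hp.ae_inv_eq hμ hab hpc hp0 hi, e3, hg] with x hx h1 h2 h3 h4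
  have hpx := hp0 x hx
  have hmx := hm0 x hx
  have hs := hsum x hx
  have h5 : i' x = -(p' x / (p x * p x)) := by
    field_simp at h2 ⊢
    linear_combination -h2
  have h6 : k x + κ = (u x + v x) * (m x * p x) - h x := by
    rw [hs]
    field_simp
    ring
  have key : p x * (u' x - ((κ + k x) / m x * i' x + (m x)⁻¹ * q' x)) =
      v x * p' x + pu' x + g' x := by
    rw [add_comm κ, h6, h1, h3, h4, h5]
    field_simp
    ring
  rw [eq_neg_iff_add_eq_zero, ← key, mul_eq_zero, or_iff_right hpx.ne', sub_eq_zero]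

/-- Density of `m (p u) + p (m v)`. -/
lemma mul_add_mul (hμ : μ (Icc a b)ᶜ = 0) (hab : a ≤ b)
    (hp : HasStieltjesDensity a b μ p p') (hpc : ContinuousOn p (Icc a b))
    (hm : HasStieltjesDensity a b μ m m') (hmc : ContinuousOn m (Icc a b))
    (hpu : HasStieltjesDensity a b μ (fun x => p x * u x) pu')
    (hmv : HasStieltjesDensity a b μ (fun x => m x * v x) mv') :
    HasStieltjesDensity a b μ (fun x => m x * (p x * u x) + p x * (m x * v x))
      (fun x => m x * pu' x + p x * u x * m' x + (p x * mv' x + m x * v x * p' x)) :=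
  (hm.mul hμ hab hmc hpu).add (hp.mul hμ hab hpc hmv) hab

/-- Under the algebraic identity for `u + v`, the two equations are equivalent. -/
lemma ae_equation_iff_ae_equation (hμ : μ (Icc a b)ᶜ = 0) (hab : a ≤ b)
    (hp : HasStieltjesDensity a b μ p p') (hpc : ContinuousOn p (Icc a b))
    (hm : HasStieltjesDensity a b μ m m') (hmc : ContinuousOn m (Icc a b))
    (hp0 : ∀ x ∈ Icc a b, 0 < p x) (hm0 : ∀ x ∈ Icc a b, 0 < m x)
    (hh : HasStieltjesDensity a b μ h h') (hk : HasStieltjesDensity a b μ k k')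
    (hpu : HasStieltjesDensity a b μ (fun x => p x * u x) pu')
    (hmv : HasStieltjesDensity a b μ (fun x => m x * v x) mv')
    (hg : ∀ᵐ x ∂μ, h' x = -(m x * g' x)) (he : ∀ᵐ x ∂μ, k' x = -(p x * e' x))
    (hsum : ∀ x ∈ Icc a b, u x + v x = (κ + h x + k x) / (m x * p x)) :
    (∀ᵐ x ∂μ, v x * p' x + pu' x = -g' x) ↔ ∀ᵐ x ∂μ, u x * m' x + mv' x = -e' x := by
  have hR := ((HasStieltjesDensity.const a b κ μ).add hh hab).add hk hab
  have hL := (mul_add_mul hμ hab hp hpc hm hmc hpu hmv).congr_fun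
    (g := fun x => κ + h x + k x) (fun x hx => ?_) hab hR.bv
  · refine eventually_congr ?_
    filter_upwards [mem_ae_iff.2 hμ, hL.ae_eq hμ hab hR, hg, he] with x hx h1 h2 h3
    have hpx := hp0 x hx
    have hmx := hm0 x hx
    simp only [Pi.zero_apply, h2, h3] at h1
    have key : m x * (v x * p' x + pu' x + g' x) = -(p x * (u x * m' x + mv' x + e' x)) := by
      linear_combination h1
    rw [eq_neg_iff_add_eq_zero, eq_neg_iff_add_eq_zero]
    constructor <;> intro h0 <;> rw [h0] at key
    · simpa [hpx.ne'] using key.symm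
    · simpa [hmx.ne'] using key
  · have hpx := hp0 x hx
    have hmx := hm0 x hx
    have h6 : κ + h x + k x = (u x + v x) * (m x * p x) := by
      rw [hsum x hx]
      field_simp
    simp only [h6]
    ring

/-- The two equations together imply the algebraic identity for `u + v`. -/
lemma exists_const_of_ae_equations (hμ : μ (Icc a b)ᶜ = 0) (hab : a ≤ b)
    (hp : HasStieltjesDensity a b μ p p') (hpc : ContinuousOn p (Icc a b))
    (hm : HasStieltjesDensity a b μ m m') (hmc : ContinuousOn m (Icc a b))
    (hp0 : ∀ x ∈ Icc a b, 0 < p x) (hm0 : ∀ x ∈ Icc a b, 0 < m x)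
    (hh : HasStieltjesDensity a b μ h h') (hk : HasStieltjesDensity a b μ k k')
    (hpu : HasStieltjesDensity a b μ (fun x => p x * u x) pu')
    (hmv : HasStieltjesDensity a b μ (fun x => m x * v x) mv')
    (hg : ∀ᵐ x ∂μ, h' x = -(m x * g' x)) (he : ∀ᵐ x ∂μ, k' x = -(p x * e' x))
    (hu : BoundedVariationOn u (Icc a b))
    (hv : BoundedVariationOn v (Icc a b))
    (hul : ∀ x ∈ Ioc a b, ContinuousWithinAt (fun x => p x * u x) (Iio x) x)
    (hhl : ∀ x ∈ Ioc a b, ContinuousWithinAt h (Iio x) x)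
    (hvr : ∀ x ∈ Ico a b, ContinuousWithinAt v (Ioi x) x)
    (hkr : ∀ x ∈ Ico a b, ContinuousWithinAt k (Ioi x) x)
    (h1 : ∀ᵐ x ∂μ, v x * p' x + pu' x = -g' x) (h2 : ∀ᵐ x ∂μ, u x * m' x + mv' x = -e' x) :
    ∃ κ, ∀ x ∈ Icc a b, u x + v x = (κ + h x + k x) / (m x * p x) := by
  obtain ⟨κ, hκ⟩ := (mul_add_mul hμ hab hp hpc hm hmc hpu hmv).exists_rLim_eq_const_add
    (hh.add hk hab) (by
      filter_upwards [h1, h2, hg, he] with x h1 h2 h3 h4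
      rw [h3, h4]
      linear_combination m x * h1 + p x * h2)
  refine ⟨κ, fun x hx => ?_⟩
  have hpx := hp0 x hx
  have hmx := hm0 x hx
  have hκx := hκ x hx
  rw [rLim_add (hm.bv.fun_mul hpu.bv) (hp.bv.fun_mul hmv.bv) hx, rLim_mul hm.bv hpu.bv hx,
    rLim_mul hp.bv hmv.bv hx, rLim_mul hp.bv hu hx, rLim_mul hm.bv hv hx, rLim_add hh.bv hk.bv hx,
    hpc.rLim_eq hx, hmc.rLim_eq hx, rLim_eq_self hvr hx, rLim_eq_self hkr hx] at hκx
  have j1 := hpu.setIntegral_singleton hul hx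
  have j2 := hh.setIntegral_singleton hhl hx
  have j3 := hp.setIntegral_singleton_eq_zero hpc hx
  rw [rLim_mul hp.bv hu hx, hpc.rLim_eq hx] at j1
  have j4 : ∫ t in {x}, h' t ∂μ = m x * ∫ t in {x}, pu' t ∂μ := by
    have : ∀ᵐ t ∂μ, h' t = m t * (v t * p' t + pu' t) := by
      filter_upwards [h1, hg] with t h1 h2
      rw [h1, h2]
      ring
    rw [integral_congr_ae (ae_restrict_of_ae this)]
    rw [integral_singleton, smul_eq_mul] at j3 ⊢
    rw [integral_singleton, smul_eq_mul]
    linear_combination m x * v x * j3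
  rw [j1, j2] at j4
  rw [eq_div_iff (by positivity)]
  linear_combination hκx + j4

end HasStieltjesDensity

namespace MeasureTheory.SignedMeasure

variable {a b : ℝ} {μ : Measure ℝ} [IsFiniteMeasure μ] {ν ν₁ ν₂ : SignedMeasure ℝ}
  {g g₁ g₂ : ℝ → ℝ}

lemma eq_neg_sInt_iff (h : ν.totalVariation ≪ μ) (h₁ : ν₁.totalVariation ≪ μ)
    (hμ : μ (Icc a b)ᶜ = 0) (hg : BoundedVariationOn g (Icc a b)) :
    (∀ s, MeasurableSet s → ν s = -sInt ν₁ g s) ↔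
      ∀ᵐ x ∂μ, ν.density μ x = -(g x * ν₁.density μ x) := by
  rw [← EventuallyEq, ← forall_setIntegral_eq_iff (ν.integrable_density μ)
    (hg.integrable_mul hμ (ν₁.integrable_density μ)).fun_neg]
  refine forall₂_congr fun s hs => ?_
  rw [setIntegral_density h hs, integral_neg, sInt_eq_setIntegral h₁ hμ hg]

lemma sInt_add_eq_neg_iff (h₁ : ν₁.totalVariation ≪ μ) (h : ν.totalVariation ≪ μ)
    (h₂ : ν₂.totalVariation ≪ μ) (hμ : μ (Icc a b)ᶜ = 0) (hg : BoundedVariationOn g (Icc a b)) :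
    (∀ s, MeasurableSet s → sInt ν₁ g s + ν s = -ν₂ s) ↔
      ∀ᵐ x ∂μ, g x * ν₁.density μ x + ν.density μ x = -ν₂.density μ x := by
  have hint := hg.integrable_mul hμ (ν₁.integrable_density μ)
  rw [← EventuallyEq, ← forall_setIntegral_eq_iff (hint.fun_add (ν.integrable_density μ))
    (ν₂.integrable_density μ).fun_neg]
  refine forall₂_congr fun s hs => ?_
  rw [integral_add hint.integrableOn (ν.integrable_density μ).integrableOn,
    setIntegral_density h hs, integral_neg, setIntegral_density h₂ hs,
    sInt_eq_setIntegral h₁ hμ hg]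

lemma eq_sInt_add_sInt_iff (h : ν.totalVariation ≪ μ) (h₁ : ν₁.totalVariation ≪ μ)
    (h₂ : ν₂.totalVariation ≪ μ) (hμ : μ (Icc a b)ᶜ = 0)
    (hg₁ : BoundedVariationOn g₁ (Icc a b)) (hg₂ : BoundedVariationOn g₂ (Icc a b)) :
    (∀ s, MeasurableSet s → ν s = sInt ν₁ g₁ s + sInt ν₂ g₂ s) ↔
      ∀ᵐ x ∂μ, ν.density μ x = g₁ x * ν₁.density μ x + g₂ x * ν₂.density μ x := by
  have hint₁ := hg₁.integrable_mul hμ (ν₁.integrable_density μ)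
  have hint₂ := hg₂.integrable_mul hμ (ν₂.integrable_density μ)
  rw [← EventuallyEq, ← forall_setIntegral_eq_iff (ν.integrable_density μ) (hint₁.fun_add hint₂)]
  refine forall₂_congr fun s hs => ?_
  rw [integral_add hint₁.integrableOn hint₂.integrableOn, setIntegral_density h hs,
    sInt_eq_setIntegral h₁ hμ hg₁, sInt_eq_setIntegral h₂ hμ hg₂]

end MeasureTheory.SignedMeasure

/-- integrated equation: under (A3) and (A6), a pair of bounded weight
functions `(wm, wp)` of bounded variation (with `wm` left-continuous and `wp`
right-continuous) satisfies the differential equations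
`wp dλ₊ + d(λ₊ wm) = −dgm` and `wm dλ₋ + d(λ₋ wp) = −dgp` if and only if there is a
constant `κ` such that
`dwm = ((κ + hp)/λ₋) d(1/λ₊) + (1/λ₋) d(hm/λ₊)`,
`dwp = ((κ + hm)/λ₊) d(1/λ₋) + (1/λ₊) d(hp/λ₋)`, and
`wm + wp = (κ + hm + hp)/(λ₋ λ₊)` on `[a,b]`; moreover, given the last identity, the
first two equations imply each other.  All Lebesgue-Stieltjes measures involved are
supplied through the hypotheses below. -/
theorem stmt4 (a b : ℝ) (hab : a < b) (lm lp : ℝ → ℝ)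
    (hA3 : A3 a b lm lp) (hA6 : A6 a b lm lp)
    (gm gp hm hp wm wp : ℝ → ℝ)
    -- regularity of gm, gp
    (hgmB : ∃ C, ∀ x ∈ Set.Icc a b, |gm x| ≤ C)
    (hgpB : ∃ C, ∀ x ∈ Set.Icc a b, |gp x| ≤ C)
    (hgmBV : BoundedVariationOn gm (Set.Icc a b))
    (hgpBV : BoundedVariationOn gp (Set.Icc a b))
    (hgmL : ∀ x ∈ Set.Ioc a b, ContinuousWithinAt gm (Set.Iio x) x)
    (hgpR : ∀ x ∈ Set.Ico a b, ContinuousWithinAt gp (Set.Ioi x) x)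
    -- regularity of hm, hp
    (hhmB : ∃ C, ∀ x ∈ Set.Icc a b, |hm x| ≤ C)
    (hhpB : ∃ C, ∀ x ∈ Set.Icc a b, |hp x| ≤ C)
    (hhmBV : BoundedVariationOn hm (Set.Icc a b))
    (hhpBV : BoundedVariationOn hp (Set.Icc a b))
    (hhmL : ∀ x ∈ Set.Ioc a b, ContinuousWithinAt hm (Set.Iio x) x)
    (hhpR : ∀ x ∈ Set.Ico a b, ContinuousWithinAt hp (Set.Ioi x) x)
    -- regularity of wm, wp
    (hwmB : ∃ C, ∀ x ∈ Set.Icc a b, |wm x| ≤ C)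
    (hwpB : ∃ C, ∀ x ∈ Set.Icc a b, |wp x| ≤ C)
    (hwmBV : BoundedVariationOn wm (Set.Icc a b))
    (hwpBV : BoundedVariationOn wp (Set.Icc a b))
    (hwmL : ∀ x ∈ Set.Ioc a b, ContinuousWithinAt wm (Set.Iio x) x)
    (hwpR : ∀ x ∈ Set.Ico a b, ContinuousWithinAt wp (Set.Ioi x) x)
    -- the Lebesgue-Stieltjes measures involved
    (νgm νgp νhm νhp νwm νwp νlm νlp νip νim νhmlp νhplm νpwm νmwp :
      MeasureTheory.SignedMeasure ℝ)
    (hνgm : IsLS a b gm νgm) (hνgp : IsLS a b gp νgp)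
    (hνhm : IsLS a b hm νhm) (hνhp : IsLS a b hp νhp)
    (hνwm : IsLS a b wm νwm) (hνwp : IsLS a b wp νwp)
    (hνlm : IsLS a b lm νlm) (hνlp : IsLS a b lp νlp)
    (hνip : IsLS a b (fun x => (lp x)⁻¹) νip)
    (hνim : IsLS a b (fun x => (lm x)⁻¹) νim)
    (hνhmlp : IsLS a b (fun x => hm x / lp x) νhmlp)
    (hνhplm : IsLS a b (fun x => hp x / lm x) νhplm)
    (hνpwm : IsLS a b (fun x => lp x * wm x) νpwm)
    (hνmwp : IsLS a b (fun x => lm x * wp x) νmwp)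
    -- dh₋ = −λ₋ dg₋ and dh₊ = −λ₊ dg₊
    (hhm : ∀ s : Set ℝ, MeasurableSet s → νhm s = - sInt νgm lm s)
    (hhp : ∀ s : Set ℝ, MeasurableSet s → νhp s = - sInt νgp lp s) :
    ((∀ s : Set ℝ, MeasurableSet s →
        sInt νlp wp s + νpwm s = - νgm s ∧ sInt νlm wm s + νmwp s = - νgp s) ↔
      ∃ κ : ℝ,
        (∀ s : Set ℝ, MeasurableSet s →
          νwm s = sInt νip (fun x => (κ + hp x) / lm x) s +
            sInt νhmlp (fun x => (lm x)⁻¹) s) ∧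
        (∀ s : Set ℝ, MeasurableSet s →
          νwp s = sInt νim (fun x => (κ + hm x) / lp x) s +
            sInt νhplm (fun x => (lp x)⁻¹) s) ∧
        (∀ x ∈ Set.Icc a b, wm x + wp x = (κ + hm x + hp x) / (lm x * lp x))) ∧
    (∀ κ : ℝ, (∀ x ∈ Set.Icc a b, wm x + wp x = (κ + hm x + hp x) / (lm x * lp x)) →
      ((∀ s : Set ℝ, MeasurableSet s →
          νwm s = sInt νip (fun x => (κ + hp x) / lm x) s +
            sInt νhmlp (fun x => (lm x)⁻¹) s) ↔
        (∀ s : Set ℝ, MeasurableSet s →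
          νwp s = sInt νim (fun x => (κ + hm x) / lp x) s +
            sInt νhplm (fun x => (lp x)⁻¹) s))) := by
  obtain ⟨hmc, hpc, hmanti, hpmono, -, -⟩ := hA3
  obtain ⟨hpa, hmb⟩ := hA6
  have hp0 : ∀ x ∈ Icc a b, 0 < lp x := fun x hx =>
    hpa.trans_le (hpmono ⟨le_rfl, hab.le⟩ hx hx.1)
  have hm0 : ∀ x ∈ Icc a b, 0 < lm x := fun x hx =>
    hmb.trans_le (hmanti hx ⟨hab.le, le_rfl⟩ hx.2)
  have hpBV : BoundedVariationOn lp (Icc a b) := hpmono.boundedVariationOn_Icc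
  have hmBV : BoundedVariationOn lm (Icc a b) := hmanti.boundedVariationOn_Icc
  have hipBV : BoundedVariationOn (fun x => (lp x)⁻¹) (Icc a b) :=
    AntitoneOn.boundedVariationOn_Icc fun x hx y hy hxy =>
      inv_anti₀ (hp0 x hx) (hpmono hx hy hxy)
  have himBV : BoundedVariationOn (fun x => (lm x)⁻¹) (Icc a b) :=
    MonotoneOn.boundedVariationOn_Icc fun x hx y hy hxy =>
      inv_anti₀ (hm0 y hy) (hmanti hx hy hxy)
  have hkpBV : ∀ κ, BoundedVariationOn (fun x => (κ + hp x) / lm x) (Icc a b) := fun κ => by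
    simpa only [div_eq_mul_inv] using
      ((BoundedVariationOn.const_real κ _).fun_add_real hhpBV).fun_mul himBV
  have hkmBV : ∀ κ, BoundedVariationOn (fun x => (κ + hm x) / lp x) (Icc a b) := fun κ => by
    simpa only [div_eq_mul_inv] using
      ((BoundedVariationOn.const_real κ _).fun_add_real hhmBV).fun_mul hipBV
  obtain ⟨μ, _, hμ, hdom⟩ := SignedMeasure.exists_dominating measurableSet_Icc
    [νgm, νgp, νhm, νhp, νwm, νwp, νlm, νlp, νip, νim, νhmlp, νhplm, νpwm, νmwp] (by
      simp only [List.forall_mem_cons]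
      exact ⟨hνgm.1, hνgp.1, hνhm.1, hνhp.1, hνwm.1, hνwp.1, hνlm.1, hνlp.1, hνip.1, hνim.1,
        hνhmlp.1, hνhplm.1, hνpwm.1, hνmwp.1, by simp⟩)
  simp only [List.forall_mem_cons] at hdom
  obtain ⟨agm, agp, ahm, ahp, awm, awp, alm, alp, aip, aim, ahmlp, ahplm, apwm, amwp, -⟩ := hdom
  have dhm := SignedMeasure.hasStieltjesDensity ahm hhmBV hνhm
  have dhp := SignedMeasure.hasStieltjesDensity ahp hhpBV hνhp
  have dwm := SignedMeasure.hasStieltjesDensity awm hwmBV hνwm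
  have dwp := SignedMeasure.hasStieltjesDensity awp hwpBV hνwp
  have dlm := SignedMeasure.hasStieltjesDensity alm hmBV hνlm
  have dlp := SignedMeasure.hasStieltjesDensity alp hpBV hνlp
  have dip := SignedMeasure.hasStieltjesDensity aip hipBV hνip
  have dim := SignedMeasure.hasStieltjesDensity aim himBV hνim
  have dhmlp := SignedMeasure.hasStieltjesDensity ahmlp
    (by simpa only [div_eq_mul_inv] using hhmBV.fun_mul hipBV) hνhmlp
  have dhplm := SignedMeasure.hasStieltjesDensity ahplm
    (by simpa only [div_eq_mul_inv] using hhpBV.fun_mul himBV) hνhplm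
  have dpwm := SignedMeasure.hasStieltjesDensity apwm (hpBV.fun_mul hwmBV) hνpwm
  have dmwp := SignedMeasure.hasStieltjesDensity amwp (hmBV.fun_mul hwpBV) hνmwp
  have ehm := (SignedMeasure.eq_neg_sInt_iff ahm agm hμ hmBV).1 hhm
  have ehp := (SignedMeasure.eq_neg_sInt_iff ahp agp hμ hpBV).1 hhp
  have iff1 := SignedMeasure.sInt_add_eq_neg_iff alp apwm agm hμ hwpBV
  have iff2 := SignedMeasure.sInt_add_eq_neg_iff alm amwp agp hμ hwmBV
  have iffa := fun κ => SignedMeasure.eq_sInt_add_sInt_iff awm aip ahmlp hμ (hkpBV κ) himBV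
  have iffb := fun κ => SignedMeasure.eq_sInt_add_sInt_iff awp aim ahplm hμ (hkmBV κ) hipBV
  have hsymm : ∀ κ, (∀ x ∈ Icc a b, wm x + wp x = (κ + hm x + hp x) / (lm x * lp x)) →
      ∀ x ∈ Icc a b, wp x + wm x = (κ + hp x + hm x) / (lp x * lm x) := fun κ h x hx => by
    rw [add_comm, h x hx, add_right_comm, mul_comm]
  have key1 := fun κ (h : ∀ x ∈ Icc a b, wm x + wp x = (κ + hm x + hp x) / (lm x * lp x)) =>
    HasStieltjesDensity.ae_equation_iff hμ hab.le dlp hpc hp0 hm0 dip dhm dwm dpwm dhmlp ehm h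
  have key2 := fun κ (h : ∀ x ∈ Icc a b, wm x + wp x = (κ + hm x + hp x) / (lm x * lp x)) =>
    HasStieltjesDensity.ae_equation_iff hμ hab.le dlm hmc hm0 hp0 dim dhp dwp dmwp dhplm ehp
      (hsymm κ h)
  rw [forall₂_and, iff1, iff2]
  simp only [iffa, iffb]
  refine ⟨⟨fun ⟨h1, h2⟩ => ?_, ?_⟩, fun κ h => ?_⟩
  · obtain ⟨κ, hκ⟩ := HasStieltjesDensity.exists_const_of_ae_equations hμ hab.le dlp hpc dlm hmc
      hp0 hm0 dhm dhp dpwm dmwp ehm ehp hwmBV hwpBV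
      (fun x hx => (hpc.continuousWithinAt_Iio hx).mul (hwmL x hx)) hhmL hwpR hhpR h1 h2
    exact ⟨κ, (key1 κ hκ).1 h1, (key2 κ hκ).1 h2, hκ⟩
  · rintro ⟨κ, h1, h2, hκ⟩
    exact ⟨(key1 κ hκ).2 h1, (key2 κ hκ).2 h2⟩
  · rw [← key1 κ h, ← key2 κ h]
    exact HasStieltjesDensity.ae_equation_iff_ae_equation hμ hab.le dlp hpc dlm hmc hp0 hm0 dhm
      dhp dpwm dmwp ehm ehp h
end
end
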